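/- arXiv:0905.0092 — 7 statements merged into one kernel-verified Lean document; each statement's English description precedes it below -/
import Mathlib

section
/- Let H be a real Hilbert space, φ : H → ℝ a convex differentiable function whose gradient ∇φ is Lipschitz continuous on bounded subsets of H, and A : H → H a maximal monotone operator that is λ-cocoercive for some λ > 0. Let γ > 0 satisfy λγ² > 1, and suppose the set S := (∇φ + A)⁻¹(0) is nonempty. Then for any initial data u₀, v₀ ∈ H, the unique solution u ∈ C²([0,∞); H) of ü(t) + γ u̇(t) + ∇φ(u(t)) + A(u(t)) = 0 with u(0) = u₀, u̇(0) = v₀ converges weakly in H, as t → +∞, to some element u_∞ ∈ S. -/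
open Filter MeasureTheory Set Bornology
open scoped RealInnerProductSpace NNReal Topology

section WeakConvergence

variable {H : Type*} [NormedAddCommGroup H] [InnerProductSpace ℝ H]

/-- Bounded families in a Hilbert space have weak limits along ultrafilters. -/
lemma exists_weak_limit_of_ultrafilter [CompleteSpace H] {ι : Type*} (F : Ultrafilter ι)
    {u : ι → H} {R : ℝ} (hR : ∀ᶠ t in (F : Filter ι), ‖u t‖ ≤ R) :
    ∃ x : H, ∀ y, Tendsto (fun t => ⟪u t, y⟫) F (𝓝 ⟪x, y⟫) := by
  let D : ι → WeakDual ℝ H := fun t =>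
    StrongDual.toWeakDual (InnerProductSpace.toDual ℝ H (u t))
  obtain ⟨ℓ, -, hℓ⟩ := (WeakDual.isCompact_closedBall (𝕜 := ℝ) (E := H) 0 R).ultrafilter_le_nhds
    (F.map D) (by
      rw [le_principal_iff]
      change ∀ᶠ t in (F : Filter ι), D t ∈ _
      filter_upwards [hR] with t ht
      simpa [D] using ht)
  refine ⟨(InnerProductSpace.toDual ℝ H).symm (WeakDual.toStrongDual ℓ), fun y => ?_⟩
  have h : Tendsto D F (𝓝 ℓ) := hℓ
  rw [InnerProductSpace.toDual_symm_apply]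
  exact ((WeakDual.eval_continuous y).tendsto ℓ).comp h

/-- Opial's lemma. -/
lemma exists_weak_limit_of_opial [CompleteSpace H] {ι : Type*} {l : Filter ι} [l.NeBot]
    {u : ι → H} {S : Set H} {R : ℝ} (hR : ∀ᶠ t in l, ‖u t‖ ≤ R)
    (hdist : ∀ p ∈ S, ∃ d, Tendsto (fun t => ‖u t - p‖ ^ 2) l (𝓝 d))
    (hcluster : ∀ F : Ultrafilter ι, (F : Filter ι) ≤ l → ∀ x : H,
      (∀ y, Tendsto (fun t => ⟪u t, y⟫) F (𝓝 ⟪x, y⟫)) → x ∈ S) :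
    ∃ x ∈ S, ∀ y, Tendsto (fun t => ⟪u t, y⟫) l (𝓝 ⟪x, y⟫) := by
  obtain ⟨x, hx⟩ := exists_weak_limit_of_ultrafilter (Ultrafilter.of l)
    (hR.filter_mono (Ultrafilter.of_le l))
  have hxS := hcluster _ (Ultrafilter.of_le l) x hx
  refine ⟨x, hxS, fun y => ?_⟩
  rw [tendsto_iff_ultrafilter]
  intro G hG
  obtain ⟨z, hz⟩ := exists_weak_limit_of_ultrafilter G (hR.filter_mono hG)
  obtain ⟨dx, hdx⟩ := hdist x hxS
  obtain ⟨dz, hdz⟩ := hdist z (hcluster G hG z hz)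
  have hlim : Tendsto (fun t => ⟪u t, x - z⟫) l
      (𝓝 ((dz - dx + ‖x‖ ^ 2 - ‖z‖ ^ 2) / 2)) := by
    have h := (((hdz.sub hdx).add_const (‖x‖ ^ 2)).sub_const (‖z‖ ^ 2)).div_const 2
    refine h.congr fun t => ?_
    rw [norm_sub_sq_real, norm_sub_sq_real, inner_sub_right]
    ring
  have h₁ := tendsto_nhds_unique (hx (x - z)) (hlim.mono_left (Ultrafilter.of_le l))
  have h₂ := tendsto_nhds_unique (hz (x - z)) (hlim.mono_left hG)
  have hxz : x = z := by
    rw [← sub_eq_zero, ← inner_self_eq_zero (𝕜 := ℝ), inner_sub_left, h₁, h₂, sub_self]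
  rw [hxz]
  exact hz y

/-- Demiclosedness at `0` of a continuous monotone operator. -/
lemma eq_zero_of_weak_limit_of_monotone {ι : Type*} {F : Filter ι} [F.NeBot] {T : H → H}
    (hT : Continuous T) (hmono : ∀ v w, 0 ≤ ⟪T v - T w, v - w⟫) {u : ι → H} {R : ℝ}
    (hR : ∀ᶠ t in F, ‖u t‖ ≤ R) (hTu : Tendsto (fun t => T (u t)) F (𝓝 0)) {x : H}
    (hx : ∀ y, Tendsto (fun t => ⟪u t, y⟫) F (𝓝 ⟪x, y⟫)) : T x = 0 := by
  have minty : ∀ y, 0 ≤ ⟪T y, y - x⟫ := fun y => by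
    have hzero : Tendsto (fun t => ⟪T (u t), y - u t⟫) F (𝓝 0) := by
      have hb : Tendsto (fun t => ‖T (u t)‖ * (‖y‖ + R)) F (𝓝 0) := by
        simpa using hTu.norm.mul_const (‖y‖ + R)
      refine squeeze_zero_norm' ?_ hb
      filter_upwards [hR] with t ht
      refine (norm_inner_le_norm _ _).trans ?_
      gcongr
      exact (norm_sub_le _ _).trans (by gcongr)
    have h := ((tendsto_const_nhds (x := ⟪T y, y⟫)).sub (hx (T y))).sub hzero
    have hle := ge_of_tendsto h (b := 0) (Eventually.of_forall fun t => by
      have := hmono y (u t)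
      rw [inner_sub_left, inner_sub_right (T y), real_inner_comm (u t) (T y)] at this
      exact this)
    rw [inner_sub_right, real_inner_comm x]
    linarith
  have hray : ∀ s : ℝ, 0 < s → 0 ≤ ⟪T (x - s • T x), - T x⟫ := fun s hs => by
    have h := minty (x - s • T x)
    rw [show x - s • T x - x = s • (- T x) by rw [smul_neg]; abel, inner_smul_right] at h
    exact nonneg_of_mul_nonneg_right h hs
  have hcont : Continuous fun s : ℝ => ⟪T (x - s • T x), - T x⟫ := by fun_prop
  have hlim : Tendsto (fun s : ℝ => ⟪T (x - s • T x), - T x⟫) (𝓝[>] 0) (𝓝 ⟪T x, - T x⟫) := by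
    have h := hcont.tendsto 0
    simp only [zero_smul, sub_zero] at h
    exact h.mono_left nhdsWithin_le_nhds
  have h := ge_of_tendsto hlim (b := 0)
    (by filter_upwards [self_mem_nhdsWithin] with s hs using hray s hs)
  rw [inner_neg_right, real_inner_self_eq_norm_sq] at h
  exact norm_eq_zero.1 (pow_eq_zero_iff two_ne_zero |>.1 (le_antisymm (by linarith) (sq_nonneg _)))

end WeakConvergence

section Lyapunov

lemma antitoneOn_of_hasDerivWithinAt_Ici {W W' : ℝ → ℝ} {s : Set ℝ} (hs : s ⊆ Ici 0)
    (hconv : Convex ℝ s) (hW : ∀ t ∈ Ici (0 : ℝ), HasDerivWithinAt W (W' t) (Ici 0) t)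
    (hneg : ∀ t ∈ s, W' t ≤ 0) : AntitoneOn W s :=
  antitoneOn_of_hasDerivWithinAt_nonpos hconv
    (fun t ht => (hW t (hs ht)).continuousWithinAt.mono hs)
    (fun t ht => (hW t (hs (interior_subset ht))).mono (interior_subset.trans hs))
    (fun t ht => hneg t (interior_subset ht))

/-- A Lipschitz dissipation rate of a Lyapunov function that is bounded below tends to zero. -/
lemma tendsto_of_lyapunov {W W' g : ℝ → ℝ} {B K : ℝ}
    (hW : ∀ t ∈ Ici (0 : ℝ), HasDerivWithinAt W (W' t) (Ici 0) t)
    (hB : ∀ t ∈ Ici (0 : ℝ), B ≤ W t) (hg : ∀ t ∈ Ici (0 : ℝ), 0 ≤ g t)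
    (hdiss : ∀ t ∈ Ici (0 : ℝ), W' t ≤ - g t)
    (hK : ∀ t ∈ Ici (0 : ℝ), ∀ s ∈ Ici (0 : ℝ), |g s - g t| ≤ K * |s - t|) :
    (∃ l, Tendsto W atTop (𝓝 l)) ∧ Tendsto g atTop (𝓝 0) := by
  have hanti : AntitoneOn W (Ici 0) := antitoneOn_of_hasDerivWithinAt_Ici subset_rfl
    (convex_Ici 0) hW fun t ht => (hdiss t ht).trans (neg_nonpos.2 (hg t ht))
  obtain ⟨l, hl⟩ : ∃ l, Tendsto W atTop (𝓝 l) := by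
    have hanti' : Antitone fun t => W (max t 0) := fun s t hst =>
      hanti (mem_Ici.2 (le_max_right _ _)) (mem_Ici.2 (le_max_right _ _)) (max_le_max_right 0 hst)
    refine ⟨_, (tendsto_atTop_ciInf hanti' ⟨B, ?_⟩).congr' ?_⟩
    · rintro _ ⟨t, rfl⟩
      exact hB _ (mem_Ici.2 (le_max_right _ _))
    · filter_upwards [eventually_ge_atTop 0] with t ht
      rw [max_eq_left ht]
  refine ⟨⟨l, hl⟩, ?_⟩
  rw [Metric.tendsto_atTop']
  intro ε hε
  set η := ε / (2 * (|K| + 1)) with hη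
  have hη0 : 0 < η := by positivity
  have hKη : |K| * η ≤ ε / 2 := by
    rw [hη, mul_div_assoc', div_le_div_iff₀ (by positivity) two_pos]
    nlinarith [abs_nonneg K]
  have hdrop : Tendsto (fun t => W t - W (t + η)) atTop (𝓝 0) := by
    simpa using hl.sub (hl.comp (tendsto_atTop_add_const_right _ η tendsto_id))
  obtain ⟨N, hN⟩ := eventually_atTop.1
    ((hdrop.eventually_lt_const (show 0 < η * (ε / 2) by positivity)).and (eventually_ge_atTop 0))
  refine ⟨N, fun t ht => ?_⟩
  obtain ⟨hlt, ht0⟩ := hN t ht.le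
  rw [Real.dist_eq, sub_zero, abs_of_nonneg (hg t ht0)]
  by_contra! hge
  have hsub : Icc t (t + η) ⊆ Ici 0 := fun s hs => ht0.trans hs.1
  have hanti := antitoneOn_of_hasDerivWithinAt_Ici (W := fun s => W s + ε / 2 * s)
    (W' := fun s => W' s + ε / 2) hsub (convex_Icc _ _)
    (fun s hs => by
      simpa using (hW s hs).fun_add ((hasDerivWithinAt_id s _).const_mul (ε / 2)))
    (fun s hs => by
      have h₁ := hdiss s (hsub hs)
      have h₂ := (abs_le.1 (hK t ht0 s (hsub hs))).1
      have h₃ : K * |s - t| ≤ |K| * η := by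
        rw [abs_of_nonneg (sub_nonneg.2 hs.1)]
        gcongr
        · linarith [hs.1]
        · exact le_abs_self K
        · linarith [hs.2]
      linarith)
  have := hanti (left_mem_Icc.2 (by linarith)) (right_mem_Icc.2 (by linarith))
    (show t ≤ t + η by linarith)
  simp only at this
  nlinarith

end Lyapunov

section Gradient

variable {H : Type*} [NormedAddCommGroup H] [InnerProductSpace ℝ H] [CompleteSpace H]
  {φ : H → ℝ} {φ' : H → H}

lemma ConvexOn.inner_gradient_le (hφ : ConvexOn ℝ univ φ) {x g : H} (hg : HasGradientAt φ g x)
    (y : H) : ⟪g, y - x⟫ ≤ φ y - φ x := by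
  have hconv := hφ.comp_affineMap (AffineMap.lineMap (k := ℝ) x y)
  have hderiv : HasDerivAt (φ ∘ AffineMap.lineMap x y) ⟪g, y - x⟫ (0 : ℝ) := by
    have hg' := hg.hasFDerivAt
    rw [← AffineMap.lineMap_apply_zero (k := ℝ) x y] at hg'
    simpa using hg'.comp_hasDerivAt (0 : ℝ) AffineMap.hasDerivAt_lineMap
  simpa [slope_def_field] using
    hconv.le_slope_of_hasDerivAt (mem_univ _) (mem_univ _) zero_lt_one hderiv

lemma ConvexOn.inner_gradient_sub_nonneg (hφ : ConvexOn ℝ univ φ)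
    (hφ' : ∀ x, HasGradientAt φ (φ' x) x) (x y : H) : 0 ≤ ⟪φ' x - φ' y, x - y⟫ := by
  have h₁ := hφ.inner_gradient_le (hφ' x) y
  have h₂ := hφ.inner_gradient_le (hφ' y) x
  rw [← neg_sub x y, inner_neg_right] at h₁
  rw [inner_sub_left]
  linarith

/-- On a ball, the gradient gap is controlled by the Bregman divergence. -/
lemma ConvexOn.exists_norm_gradient_sub_sq_le (hφ : ConvexOn ℝ univ φ)
    (hφ' : ∀ x, HasGradientAt φ (φ' x) x)
    (hlip : ∀ s : Set H, IsBounded s → ∃ K : ℝ≥0, LipschitzOnWith K φ' s) (p : H) (R : ℝ) :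
    ∃ C : ℝ, ∀ x, ‖x - p‖ ≤ R → ‖φ' x - φ' p‖ ^ 2 ≤ C * (φ x - φ p - ⟪φ' p, x - p⟫) := by
  obtain ⟨K, hK⟩ := hlip (Metric.closedBall p R) Metric.isBounded_closedBall
  obtain ⟨L, hL⟩ := hlip (Metric.closedBall p (R + K * R)) Metric.isBounded_closedBall
  set s : ℝ := 1 / (2 * (L + 1)) with hs
  have hs0 : 0 < s := by positivity
  have hsL : s * L ≤ 1 / 2 := by
    rw [hs, div_mul_eq_mul_div, div_le_div_iff₀ (by positivity) two_pos]
    linarith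
  have hs1 : s ≤ 1 := by
    rw [hs, div_le_one (by positivity)]
    linarith [L.coe_nonneg]
  refine ⟨2 / s, fun x hx => ?_⟩
  have hR : 0 ≤ R := (norm_nonneg _).trans hx
  set g := φ' x - φ' p with hg
  have hgR : ‖g‖ ≤ K * R := (hK.norm_sub_le (by simpa [dist_eq_norm] using hx)
    (by simpa using hR)).trans (by gcongr)
  set y := x - s • g with hy
  have hxy : x - y = s • g := by rw [hy]; abel
  have hyp : ‖y - p‖ ≤ R + K * R := by
    rw [hy, sub_right_comm]
    refine (norm_sub_le _ _).trans (add_le_add hx ?_)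
    rw [norm_smul, Real.norm_of_nonneg hs0.le]
    exact (mul_le_of_le_one_left (norm_nonneg _) hs1).trans hgR
  have hgap : ‖φ' y - φ' x‖ ≤ L * (s * ‖g‖) := by
    have h := hL.norm_sub_le (x := y) (y := x) (by simpa [dist_eq_norm] using hyp)
      (by simpa [dist_eq_norm] using hx.trans (le_add_of_nonneg_right (by positivity)))
    rwa [norm_sub_rev y, hxy, norm_smul, Real.norm_of_nonneg hs0.le] at h
  have h₁ := hφ.inner_gradient_le (hφ' y) x
  have h₂ := hφ.inner_gradient_le (hφ' p) y
  have hsplit : ⟪φ' y, x - y⟫ = ⟪φ' y - φ' x, x - y⟫ + s * ‖g‖ ^ 2 + ⟪φ' p, x - y⟫ := by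
    rw [← real_inner_self_eq_norm_sq, ← inner_smul_right, ← hxy, ← inner_add_left,
      ← inner_add_left, hg]
    congr 1
    abel
  have h₃ : -(L * (s * ‖g‖) * (s * ‖g‖)) ≤ ⟪φ' y - φ' x, x - y⟫ := by
    refine le_trans (neg_le_neg ?_) (abs_le.1 (abs_real_inner_le_norm _ _)).1
    rw [hxy, norm_smul, Real.norm_of_nonneg hs0.le]
    gcongr
  have h₄ : ⟪φ' p, x - p⟫ = ⟪φ' p, x - y⟫ + ⟪φ' p, y - p⟫ := by
    rw [← inner_add_right, sub_add_sub_cancel]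
  have h₅ : s * L * (s * ‖g‖ ^ 2) ≤ 1 / 2 * (s * ‖g‖ ^ 2) := by gcongr
  rw [div_mul_eq_mul_div, le_div_iff₀ hs0]
  linarith

lemma ConvexOn.abs_sub_le_of_gradient_bound (hφ : ConvexOn ℝ univ φ)
    (hφ' : ∀ x, HasGradientAt φ (φ' x) x) {M : ℝ} {x y : H} (hx : ‖φ' x‖ ≤ M) (hy : ‖φ' y‖ ≤ M) :
    |φ x - φ y| ≤ M * ‖x - y‖ := by
  have key : ∀ {a b : H}, ‖φ' a‖ ≤ M → φ a - φ b ≤ M * ‖a - b‖ := fun {a b} ha => by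
    have h := hφ.inner_gradient_le (hφ' a) b
    have h' := (abs_le.1 (abs_real_inner_le_norm (φ' a) (b - a))).1
    have : ‖φ' a‖ * ‖b - a‖ ≤ M * ‖a - b‖ := by rw [norm_sub_rev]; gcongr
    linarith
  rw [abs_sub_le_iff]
  exact ⟨key hx, norm_sub_rev x y ▸ key hy⟩

end Gradient

section NormSq

variable {E : Type*} [NormedAddCommGroup E]

lemma abs_norm_sq_sub_norm_sq_le {M : ℝ} {a b : E} (ha : ‖a‖ ≤ M) (hb : ‖b‖ ≤ M) :
    |‖a‖ ^ 2 - ‖b‖ ^ 2| ≤ 2 * M * ‖a - b‖ := by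
  rw [sq_sub_sq, abs_mul, abs_of_nonneg (by positivity)]
  exact mul_le_mul (by linarith) (abs_norm_sub_norm_le a b) (abs_nonneg _)
    (by linarith [norm_nonneg a])

lemma tendsto_zero_of_norm_sq_le {ι : Type*} {l : Filter ι} {f : ι → E} {g : ι → ℝ} {C : ℝ}
    (hf : ∀ᶠ t in l, ‖f t‖ ^ 2 ≤ C * g t) (hg : Tendsto g l (𝓝 0)) : Tendsto f l (𝓝 0) := by
  have h : Tendsto (fun t => ‖f t‖ ^ 2) l (𝓝 0) :=
    squeeze_zero' (Eventually.of_forall fun t => sq_nonneg _) hf (by simpa using hg.const_mul C)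
  rw [tendsto_zero_iff_norm_tendsto_zero]
  simpa [Real.sqrt_sq (norm_nonneg _)] using h.sqrt

end NormSq

section Trajectory

variable {H : Type*} [NormedAddCommGroup H] [InnerProductSpace ℝ H]

lemma norm_sub_le_of_cocoercive {A : H → H} {lam : ℝ} (hlam : 0 < lam)
    (hA : ∀ v w : H, lam * ‖A v - A w‖ ^ 2 ≤ ⟪A v - A w, v - w⟫) (v w : H) :
    ‖A v - A w‖ ≤ lam⁻¹ * ‖v - w‖ := by
  have h := (hA v w).trans (real_inner_le_norm _ _)
  rw [le_inv_mul_iff₀ hlam]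
  rcases (norm_nonneg (A v - A w)).eq_or_lt with h0 | h0
  · rw [← h0, mul_zero]
    exact norm_nonneg _
  · exact le_of_mul_le_mul_right (by nlinarith) h0

/-- The pointwise dissipation inequality behind the Lyapunov function. Here `v` is the velocity,
`d` the displacement from an equilibrium, and `a`, `b` the gaps of `A` and of the gradient. -/
lemma dissipation_le {a b d v w : H} {lam γ D : ℝ} (ha : lam * ‖a‖ ^ 2 ≤ ⟪a, d⟫)
    (hb : D ≤ ⟪b, d⟫) (hw : w = -(γ • v + b + a)) :
    2 * lam * γ * (⟪v, w⟫ + ⟪b, v⟫) + (⟪v, v⟫ + ⟪w, d⟫) + γ * ⟪d, v⟫ ≤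
      -(lam * ‖a + γ • v‖ ^ 2 + (lam * γ ^ 2 - 1) * ‖v‖ ^ 2 + D) := by
  rw [norm_add_sq_real, norm_smul, mul_pow, Real.norm_eq_abs, sq_abs, hw]
  simp only [inner_neg_left, inner_neg_right, inner_add_left, inner_add_right, inner_smul_left,
    inner_smul_right, real_inner_self_eq_norm_sq, RCLike.conj_to_real]
  rw [real_inner_comm v b, real_inner_comm v a, real_inner_comm v d]
  linarith

/-- Coercivity of the Lyapunov function. -/
lemma lyapunov_coercive {d v : H} {lam γ D : ℝ} (hlam : 0 < lam) (hγ : 0 < γ)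
    (hcond : 1 < lam * γ ^ 2) (hD : 0 ≤ D) :
    ‖v‖ ^ 2 / 2 ≤ γ * (2 * lam * γ * (‖v‖ ^ 2 / 2 + D) + ⟪v, d⟫ + γ / 2 * ‖d‖ ^ 2) ∧
    γ ^ 2 / 4 * ‖d‖ ^ 2 ≤
      γ * (2 * lam * γ * (‖v‖ ^ 2 / 2 + D) + ⟪v, d⟫ + γ / 2 * ‖d‖ ^ 2) := by
  have hexp : ∀ c : ℝ, 0 ≤ ‖v‖ ^ 2 + 2 * (c * ⟪v, d⟫) + c ^ 2 * ‖d‖ ^ 2 := fun c => by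
    have h := norm_add_sq_real v (c • d)
    rw [norm_smul, mul_pow, Real.norm_eq_abs, sq_abs, inner_smul_right] at h
    rw [← h]
    positivity
  have h₁ := hexp γ
  have h₂ := hexp (γ / 2)
  have h₃ : 0 ≤ (lam * γ ^ 2 - 1) * ‖v‖ ^ 2 := mul_nonneg (by linarith) (sq_nonneg _)
  have h₄ : 0 ≤ lam * γ ^ 2 * D := by positivity
  constructor <;> linarith

/-- Asymptotic estimates for a trajectory relative to an equilibrium `p`. -/
lemma trajectory_estimates [CompleteSpace H] {φ : H → ℝ} {φ' A : H → H} {lam γ : ℝ}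
    (hφconv : ConvexOn ℝ univ φ) (hφgrad : ∀ x, HasGradientAt φ (φ' x) x)
    (hφlip : ∀ s : Set H, IsBounded s → ∃ K : ℝ≥0, LipschitzOnWith K φ' s)
    (hlam : 0 < lam) (hAcoco : ∀ v w : H, lam * ‖A v - A w‖ ^ 2 ≤ ⟪A v - A w, v - w⟫)
    (hγ : 0 < γ) (hcond : 1 < lam * γ ^ 2) {u u' u'' : ℝ → H}
    (hu : ∀ t ∈ Ici (0 : ℝ), HasDerivWithinAt u (u' t) (Ici 0) t)
    (hu' : ∀ t ∈ Ici (0 : ℝ), HasDerivWithinAt u' (u'' t) (Ici 0) t)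
    (heq : ∀ t ∈ Ici (0 : ℝ), u'' t + γ • u' t + φ' (u t) + A (u t) = 0)
    {p : H} (hp : φ' p + A p = 0) :
    (∃ R, ∀ t ∈ Ici (0 : ℝ), ‖u t - p‖ ≤ R) ∧
    (∃ d, Tendsto (fun t => ‖u t - p‖ ^ 2) atTop (𝓝 d)) ∧
    Tendsto (fun t => φ' (u t) + A (u t)) atTop (𝓝 0) := by
  have hκ : 0 < lam * γ ^ 2 - 1 := by linarith
  set a : ℝ → H := fun t => A (u t) - A p with ha
  set b : ℝ → H := fun t => φ' (u t) - φ' p with hb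
  set D : ℝ → ℝ := fun t => φ (u t) - φ p - ⟪φ' p, u t - p⟫ with hD
  set W : ℝ → ℝ := fun t =>
    2 * lam * γ * (‖u' t‖ ^ 2 / 2 + D t) + ⟪u' t, u t - p⟫ + γ / 2 * ‖u t - p‖ ^ 2 with hW
  set g : ℝ → ℝ := fun t =>
    lam * ‖a t + γ • u' t‖ ^ 2 + (lam * γ ^ 2 - 1) * ‖u' t‖ ^ 2 + D t with hg
  have hab : ∀ t, φ' (u t) + A (u t) = b t + a t := fun t => by
    rw [ha, hb, ← sub_zero (φ' (u t) + A (u t)), ← hp]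
    simp only
    abel
  have hu''eq : ∀ t ∈ Ici (0 : ℝ), u'' t = -(γ • u' t + b t + a t) := fun t ht => by
    rw [eq_neg_iff_add_eq_zero, add_assoc (γ • u' t), ← hab, ← heq t ht]
    abel
  have hD0 : ∀ t, 0 ≤ D t := fun t => sub_nonneg.2 (hφconv.inner_gradient_le (hφgrad p) _)
  have hDb : ∀ t, D t ≤ ⟪b t, u t - p⟫ := fun t => by
    have h := hφconv.inner_gradient_le (hφgrad (u t)) p
    rw [← neg_sub (u t) p, inner_neg_right] at h
    rw [hb, inner_sub_left]
    simp only [hD]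
    linarith
  have hWderiv : ∀ t ∈ Ici (0 : ℝ), HasDerivWithinAt W
      (2 * lam * γ * (⟪u' t, u'' t⟫ + ⟪b t, u' t⟫) + (⟪u' t, u' t⟫ + ⟪u'' t, u t - p⟫)
        + γ * ⟪u t - p, u' t⟫) (Ici 0) t := fun t ht => by
    have hd := (hu t ht).sub_const p
    have hDt : HasDerivWithinAt D ⟪b t, u' t⟫ (Ici 0) t := by
      have h := (((hφgrad (u t)).hasFDerivAt.comp_hasDerivWithinAt t (hu t ht)).sub_const
        (φ p)).sub ((hasDerivWithinAt_const t (Ici 0) (φ' p)).inner ℝ hd)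
      refine h.congr_deriv ?_
      simp [hb, inner_sub_left]
    have h := ((((hu' t ht).norm_sq.div_const 2).add hDt).const_mul (2 * lam * γ)).add
      ((hu' t ht).inner ℝ hd) |>.add (hd.norm_sq.const_mul (γ / 2))
    refine h.congr_deriv ?_
    ring
  have hdiss : ∀ t ∈ Ici (0 : ℝ), _ ≤ - g t := fun t ht =>
    dissipation_le (hAcoco (u t) p) (hDb t) (hu''eq t ht)
  have hg0 : ∀ t ∈ Ici (0 : ℝ), 0 ≤ g t := fun t _ =>
    add_nonneg (by positivity) (hD0 t)
  have hanti : AntitoneOn W (Ici 0) := antitoneOn_of_hasDerivWithinAt_Ici subset_rfl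
    (convex_Ici 0) hWderiv fun t ht => (hdiss t ht).trans (neg_nonpos.2 (hg0 t ht))
  have hcoer : ∀ t, ‖u' t‖ ^ 2 / 2 ≤ γ * W t ∧ γ ^ 2 / 4 * ‖u t - p‖ ^ 2 ≤ γ * W t := fun t =>
    lyapunov_coercive hlam hγ hcond (hD0 t)
  have hW0 : ∀ t ∈ Ici (0 : ℝ), 0 ≤ W t := fun t _ =>
    nonneg_of_mul_nonneg_right (le_trans (by positivity) (hcoer t).1) hγ
  have hWle : ∀ t ∈ Ici (0 : ℝ), γ * W t ≤ γ * W 0 := fun t ht =>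
    mul_le_mul_of_nonneg_left (hanti self_mem_Ici ht ht) hγ.le
  obtain ⟨V, hV⟩ : ∃ V, ∀ t ∈ Ici (0 : ℝ), ‖u' t‖ ≤ V :=
    ⟨√(2 * (γ * W 0)), fun t ht => Real.le_sqrt_of_sq_le (by
      linarith [(hcoer t).1, hWle t ht])⟩
  obtain ⟨R, hR⟩ : ∃ R, ∀ t ∈ Ici (0 : ℝ), ‖u t - p‖ ≤ R :=
    ⟨√(γ * W 0 / (γ ^ 2 / 4)), fun t ht => Real.le_sqrt_of_sq_le (by
      rw [le_div_iff₀ (by positivity)]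
      linarith [(hcoer t).2, hWle t ht])⟩
  have hR0 : 0 ≤ R := (norm_nonneg _).trans (hR 0 self_mem_Ici)
  have hV0 : 0 ≤ V := (norm_nonneg _).trans (hV 0 self_mem_Ici)
  obtain ⟨B, hB⟩ : ∃ B, ∀ t ∈ Ici (0 : ℝ), ‖b t‖ ≤ B := by
    obtain ⟨K, hK⟩ := hφlip (Metric.closedBall p R) Metric.isBounded_closedBall
    refine ⟨K * R, fun t ht => (hK.norm_sub_le (by simpa [dist_eq_norm] using hR t ht)
      (by simpa using hR0)).trans ?_⟩
    gcongr
    exact hR t ht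
  have haR : ∀ t ∈ Ici (0 : ℝ), ‖a t‖ ≤ lam⁻¹ * R := fun t ht =>
    (norm_sub_le_of_cocoercive hlam hAcoco _ _).trans (by gcongr; exact hR t ht)
  have hvn : ∀ t ∈ Ici (0 : ℝ), ‖γ • u' t‖ ≤ γ * V := fun t ht => by
    rw [norm_smul, Real.norm_of_nonneg hγ.le]
    gcongr
    exact hV t ht
  obtain ⟨G, hG⟩ : ∃ G, ∀ t ∈ Ici (0 : ℝ), ‖u'' t‖ ≤ G :=
    ⟨γ * V + B + lam⁻¹ * R, fun t ht => by
      rw [hu''eq t ht, norm_neg]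
      exact norm_add₃_le.trans (add_le_add (add_le_add (hvn t ht) (hB t ht)) (haR t ht))⟩
  have hulip : ∀ t ∈ Ici (0 : ℝ), ∀ s ∈ Ici (0 : ℝ), ‖u s - u t‖ ≤ V * |s - t| :=
    fun t ht s hs => (convex_Ici 0).norm_image_sub_le_of_norm_hasDerivWithin_le hu hV ht hs
  have hu'lip : ∀ t ∈ Ici (0 : ℝ), ∀ s ∈ Ici (0 : ℝ), ‖u' s - u' t‖ ≤ G * |s - t| :=
    fun t ht s hs => (convex_Ici 0).norm_image_sub_le_of_norm_hasDerivWithin_le hu' hG ht hs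
  have hglip : ∀ t ∈ Ici (0 : ℝ), ∀ s ∈ Ici (0 : ℝ), |g s - g t| ≤
      (lam * (2 * (lam⁻¹ * R + γ * V) * (lam⁻¹ * V + γ * G)) +
        (lam * γ ^ 2 - 1) * (2 * V * G) + ((B + ‖φ' p‖) * V + ‖φ' p‖ * V)) * |s - t| := by
    intro t ht s hs
    have h₁ : |‖a s + γ • u' s‖ ^ 2 - ‖a t + γ • u' t‖ ^ 2| ≤
        2 * (lam⁻¹ * R + γ * V) * ((lam⁻¹ * V + γ * G) * |s - t|) := by
      have hbd : ∀ r ∈ Ici (0 : ℝ), ‖a r + γ • u' r‖ ≤ lam⁻¹ * R + γ * V := fun r hr =>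
        (norm_add_le _ _).trans (add_le_add (haR r hr) (hvn r hr))
      refine (abs_norm_sq_sub_norm_sq_le (hbd s hs) (hbd t ht)).trans ?_
      gcongr
      rw [add_sub_add_comm, ← smul_sub, add_mul, mul_assoc, mul_assoc]
      refine (norm_add_le _ _).trans (add_le_add ?_ ?_)
      · rw [ha, sub_sub_sub_cancel_right]
        refine (norm_sub_le_of_cocoercive hlam hAcoco _ _).trans ?_
        gcongr
        exact hulip t ht s hs
      · rw [norm_smul, Real.norm_of_nonneg hγ.le]
        gcongr
        exact hu'lip t ht s hs
    have h₂ : |‖u' s‖ ^ 2 - ‖u' t‖ ^ 2| ≤ 2 * V * (G * |s - t|) := by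
      refine (abs_norm_sq_sub_norm_sq_le (hV s hs) (hV t ht)).trans ?_
      gcongr
      exact hu'lip t ht s hs
    have h₃ : |φ (u s) - φ (u t)| ≤ (B + ‖φ' p‖) * (V * |s - t|) := by
      have hbd : ∀ r ∈ Ici (0 : ℝ), ‖φ' (u r)‖ ≤ B + ‖φ' p‖ := fun r hr => by
        rw [← sub_add_cancel (φ' (u r)) (φ' p)]
        exact (norm_add_le _ _).trans (by gcongr; exact hB r hr)
      refine (hφconv.abs_sub_le_of_gradient_bound hφgrad (hbd s hs) (hbd t ht)).trans ?_
      have := (norm_nonneg _).trans (hB s hs)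
      gcongr
      exact hulip t ht s hs
    have h₄ : |⟪φ' p, u s - u t⟫| ≤ ‖φ' p‖ * (V * |s - t|) :=
      (abs_real_inner_le_norm _ _).trans (by gcongr; exact hulip t ht s hs)
    have hgs : g s - g t = lam * (‖a s + γ • u' s‖ ^ 2 - ‖a t + γ • u' t‖ ^ 2) +
        (lam * γ ^ 2 - 1) * (‖u' s‖ ^ 2 - ‖u' t‖ ^ 2) +
        ((φ (u s) - φ (u t)) - ⟪φ' p, u s - u t⟫) := by
      simp only [hg, hD, inner_sub_right]
      ring
    rw [hgs]
    refine (abs_add_three _ _ _).trans ?_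
    rw [abs_mul, abs_mul, abs_of_pos hlam, abs_of_pos hκ]
    have h₅ := mul_le_mul_of_nonneg_left h₁ hlam.le
    have h₆ := mul_le_mul_of_nonneg_left h₂ hκ.le
    have h₇ := (abs_sub _ _).trans (add_le_add h₃ h₄)
    linarith
  obtain ⟨⟨l, hl⟩, hglim⟩ := tendsto_of_lyapunov hWderiv hW0 hg0 hdiss hglip
  have hge := eventually_ge_atTop (0 : ℝ)
  have hDlim : Tendsto D atTop (𝓝 0) :=
    squeeze_zero hD0 (fun t => le_add_of_nonneg_left (by positivity)) hglim
  have hvlim : Tendsto u' atTop (𝓝 0) := by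
    refine tendsto_zero_of_norm_sq_le (C := (lam * γ ^ 2 - 1)⁻¹)
      (Eventually.of_forall fun t => ?_) hglim
    rw [le_inv_mul_iff₀ hκ]
    have := hD0 t
    have : 0 ≤ lam * ‖a t + γ • u' t‖ ^ 2 := by positivity
    linarith
  have havlim : Tendsto (fun t => a t + γ • u' t) atTop (𝓝 0) := by
    refine tendsto_zero_of_norm_sq_le (C := lam⁻¹) (Eventually.of_forall fun t => ?_) hglim
    rw [le_inv_mul_iff₀ hlam]
    have := hD0 t
    have : 0 ≤ (lam * γ ^ 2 - 1) * ‖u' t‖ ^ 2 := by positivity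
    linarith
  have hblim : Tendsto b atTop (𝓝 0) := by
    obtain ⟨C, hC⟩ := hφconv.exists_norm_gradient_sub_sq_le hφgrad hφlip p R
    exact tendsto_zero_of_norm_sq_le (hge.mono fun t ht => hC (u t) (hR t ht)) hDlim
  refine ⟨⟨R, hR⟩, ⟨(l - 2 * lam * γ * (‖(0 : H)‖ ^ 2 / 2 + 0) - 0) * (2 / γ), ?_⟩, ?_⟩
  · have hin : Tendsto (fun t => ⟪u' t, u t - p⟫) atTop (𝓝 0) := by
      refine squeeze_zero_norm' (a := fun t => ‖u' t‖ * R) ?_ (by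
        simpa using hvlim.norm.mul_const R)
      filter_upwards [hge] with t ht
      exact (norm_inner_le_norm _ _).trans (by gcongr; exact hR t ht)
    have h := ((hl.sub ((((hvlim.norm.pow 2).div_const 2).add hDlim).const_mul
      (2 * lam * γ))).sub hin).mul_const (2 / γ)
    refine h.congr fun t => ?_
    simp only [hW]
    field_simp
    ring
  · have h := (hblim.add havlim).sub (hvlim.const_smul γ)
    simp only [add_zero, smul_zero, sub_zero] at h
    refine h.congr fun t => ?_
    rw [hab]
    abel

end Trajectory

/-- Weak convergence of trajectories of the second-order dissipative system
`ü + γu̇ + ∇φ(u) + A(u) = 0` towards an equilibrium, under the condition `λγ² > 1`. -/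
theorem weak_convergence_second_order_dissipative
    {H : Type*} [NormedAddCommGroup H] [InnerProductSpace ℝ H] [CompleteSpace H]
    (φ : H → ℝ) (φ' : H → H) (A : H → H) (lam γ : ℝ)
    (hφconv : ConvexOn ℝ univ φ)
    (hφgrad : ∀ x, HasGradientAt φ (φ' x) x)
    (hφlip : ∀ s : Set H, IsBounded s → ∃ K : ℝ≥0, LipschitzOnWith K φ' s)
    (hAmono : ∀ v w : H, 0 ≤ ⟪A v - A w, v - w⟫)
    (hAmax : ∀ x y : H, (∀ v : H, 0 ≤ ⟪A v - y, v - x⟫) → y = A x)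
    (hlam : 0 < lam)
    (hAcoco : ∀ v w : H, lam * ‖A v - A w‖ ^ 2 ≤ ⟪A v - A w, v - w⟫)
    (hγ : 0 < γ) (hcond : 1 < lam * γ ^ 2)
    (S : Set H) (hS : S = {v : H | φ' v + A v = 0}) (hSne : S.Nonempty)
    (u₀ v₀ : H) (u u' u'' : ℝ → H)
    (hu0 : u 0 = u₀) (hv0 : u' 0 = v₀)
    (hu : ∀ t ∈ Ici (0:ℝ), HasDerivWithinAt u (u' t) (Ici 0) t)
    (hu' : ∀ t ∈ Ici (0:ℝ), HasDerivWithinAt u' (u'' t) (Ici 0) t)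
    (hu''cont : ContinuousOn u'' (Ici 0))
    (heq : ∀ t ∈ Ici (0:ℝ), u'' t + γ • u' t + φ' (u t) + A (u t) = 0) :
    ∃ uinf ∈ S, ∀ f : H →L[ℝ] ℝ, Tendsto (fun t => f (u t)) atTop (𝓝 (f uinf)) := by
  subst hS
  have hest := fun p (hp : φ' p + A p = 0) => trajectory_estimates hφconv hφgrad hφlip hlam hAcoco
    hγ hcond hu hu' heq hp
  obtain ⟨p, hp⟩ := hSne
  obtain ⟨⟨R, hR⟩, -, hlim⟩ := hest p hp
  have hbdd : ∀ᶠ t in atTop, ‖u t‖ ≤ R + ‖p‖ := by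
    filter_upwards [eventually_ge_atTop 0] with t ht
    rw [← sub_add_cancel (u t) p]
    exact (norm_add_le _ _).trans (by gcongr; exact hR t ht)
  have hφcont : Continuous φ' := continuous_iff_continuousAt.2 fun x => by
    obtain ⟨K, hK⟩ := hφlip (Metric.ball x 1) Metric.isBounded_ball
    exact hK.continuousOn.continuousAt (Metric.ball_mem_nhds x one_pos)
  have hAcont : Continuous A :=
    (LipschitzWith.of_dist_le' (K := lam⁻¹) fun v w => by
      simpa only [dist_eq_norm] using norm_sub_le_of_cocoercive hlam hAcoco v w).continuous
  obtain ⟨x, hx, hxlim⟩ := exists_weak_limit_of_opial hbdd (fun q hq => (hest q hq).2.1)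
    (fun F hF x hx => eq_zero_of_weak_limit_of_monotone (T := fun v => φ' v + A v)
      (hφcont.add hAcont)
      (fun v w => by
        rw [add_sub_add_comm, inner_add_left]
        exact add_nonneg (hφconv.inner_gradient_sub_nonneg hφgrad v w) (hAmono v w))
      (hbdd.filter_mono hF) (hlim.mono_left hF) hx)
  refine ⟨x, hx, fun f => ?_⟩
  have hf : ∀ v, ⟪v, (InnerProductSpace.toDual ℝ H).symm f⟫ = f v := fun v => by
    rw [real_inner_comm, InnerProductSpace.toDual_symm_apply]
  simpa only [hf] using hxlim ((InnerProductSpace.toDual ℝ H).symm f)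
end

section
/- Let H be a real Hilbert space, φ : H → ℝ a convex differentiable function whose gradient ∇φ is Lipschitz continuous on bounded subsets of H, and A : H → H a maximal monotone operator that is λ-cocoercive for some λ > 0. Let γ > 0 satisfy λγ² > 1, and suppose S := (∇φ + A)⁻¹(0) is nonempty. Then for any initial data u₀, v₀ ∈ H, the solution u of ü(t) + γ u̇(t) + ∇φ(u(t)) + A(u(t)) = 0 with u(0) = u₀, u̇(0) = v₀ satisfies: for every p ∈ S, the function t ↦ ü(t) + ∇φ(u(t)) + A(p) belongs to L²(0,∞; H), i.e. ∫₀^∞ |ü(s) + ∇φ(u(s)) + Ap|² ds < ∞. -/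
open Filter MeasureTheory Set Bornology
open scoped RealInnerProductSpace NNReal Topology

/-- First-order condition for convexity: the graph lies above each tangent hyperplane. -/
theorem ConvexOn.add_inner_le_of_hasGradientAt
    {H : Type*} [NormedAddCommGroup H] [InnerProductSpace ℝ H] [CompleteSpace H]
    {φ : H → ℝ} {g x : H} (hφ : ConvexOn ℝ univ φ) (hg : HasGradientAt φ g x) (y : H) :
    φ x + ⟪g, y - x⟫ ≤ φ y := by
  have hline : ConvexOn ℝ univ (φ ∘ AffineMap.lineMap (k := ℝ) x y) := by
    simpa using hφ.comp_affineMap (AffineMap.lineMap (k := ℝ) x y)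
  have hx : HasGradientAt φ g (AffineMap.lineMap (k := ℝ) x y 0) := by simpa using hg
  have hderiv : HasDerivAt (φ ∘ AffineMap.lineMap (k := ℝ) x y) ⟪g, y - x⟫ 0 := by
    simpa using hx.hasFDerivAt.comp_hasDerivAt (0 : ℝ) AffineMap.hasDerivAt_lineMap
  have := hline.le_slope_of_hasDerivAt (mem_univ 0) (mem_univ 1) one_pos hderiv
  simp [slope_def_field] at this
  linarith

/-- A cocoercive operator is continuous. -/
theorem continuous_of_cocoercive
    {H : Type*} [NormedAddCommGroup H] [InnerProductSpace ℝ H] {A : H → H} {lam : ℝ}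
    (hlam : 0 < lam) (hA : ∀ v w : H, lam * ‖A v - A w‖ ^ 2 ≤ ⟪A v - A w, v - w⟫) :
    Continuous A := by
  refine (LipschitzWith.of_dist_le_mul (K := (lam⁻¹).toNNReal) fun v w => ?_).continuous
  rw [dist_eq_norm, dist_eq_norm, Real.coe_toNNReal _ (by positivity), inv_mul_eq_div,
    le_div_iff₀ hlam]
  rcases (norm_nonneg (A v - A w)).eq_or_lt with h | h
  · simp [← h]
  · refine le_of_mul_le_mul_left ?_ h
    nlinarith [hA v w, real_inner_le_norm (A v - A w) (v - w)]

/-- A nonnegative function dominated by the decay of a function bounded below is integrable. -/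
theorem integrableOn_Ici_of_hasDerivWithinAt_le_neg {f G G' : ℝ → ℝ} {a c m : ℝ} (hc : 0 < c)
    (hf : ContinuousOn f (Ici a)) (hf0 : ∀ t ∈ Ici a, 0 ≤ f t)
    (hG : ∀ t ∈ Ici a, HasDerivWithinAt G (G' t) (Ici a) t)
    (hG' : ∀ t ∈ Ici a, G' t ≤ -(c * f t)) (hm : ∀ t ∈ Ici a, m ≤ G t) :
    IntegrableOn f (Ici a) := by
  have hint (b : ℝ) : IntegrableOn f (Icc a b) :=
    (hf.mono Icc_subset_Ici_self).integrableOn_Icc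
  rw [integrableOn_Ici_iff_integrableOn_Ioi]
  refine integrableOn_Ioi_of_intervalIntegral_norm_bounded ((G a - m) / c) a
    (fun b : ℝ => (hint b).mono_set Ioc_subset_Icc_self) tendsto_id ?_
  filter_upwards [eventually_ge_atTop a] with b hab
  have hnorm : ∫ t in a..b, ‖f t‖ = ∫ t in a..b, f t :=
    intervalIntegral.integral_congr fun t ht => by
      rw [uIcc_of_le hab] at ht
      exact Real.norm_of_nonneg (hf0 t ht.1)
  have hle := intervalIntegral.sub_le_integral_of_hasDeriv_right_of_le hab
    (fun t ht => ((hG t ht.1).continuousWithinAt).mono Icc_subset_Ici_self)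
    (fun t ht => (hG t ht.1.le).mono ((Ioi_subset_Ioi ht.1.le).trans Ioi_subset_Ici_self))
    ((hint b).const_mul c).neg (fun t ht => hG' t ht.1.le)
  simp only [Pi.neg_apply, intervalIntegral.integral_neg,
    intervalIntegral.integral_const_mul] at hle
  rw [hnorm, le_div_iff₀ hc]
  linarith [hm b hab]

/-- For every equilibrium `p ∈ S`, the function `t ↦ ü(t) + ∇φ(u(t)) + A p` is square integrable on `[0,∞)`. -/
theorem acceleration_term_L2
    {H : Type*} [NormedAddCommGroup H] [InnerProductSpace ℝ H] [CompleteSpace H]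
    (φ : H → ℝ) (φ' : H → H) (A : H → H) (lam γ : ℝ)
    (hφconv : ConvexOn ℝ univ φ)
    (hφgrad : ∀ x, HasGradientAt φ (φ' x) x)
    (hφlip : ∀ s : Set H, IsBounded s → ∃ K : ℝ≥0, LipschitzOnWith K φ' s)
    (hAmono : ∀ v w : H, 0 ≤ ⟪A v - A w, v - w⟫)
    (hAmax : ∀ x y : H, (∀ v : H, 0 ≤ ⟪A v - y, v - x⟫) → y = A x)
    (hlam : 0 < lam)
    (hAcoco : ∀ v w : H, lam * ‖A v - A w‖ ^ 2 ≤ ⟪A v - A w, v - w⟫)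
    (hγ : 0 < γ) (hcond : 1 < lam * γ ^ 2)
    (S : Set H) (hS : S = {v : H | φ' v + A v = 0}) (hSne : S.Nonempty)
    (u₀ v₀ : H) (u u' u'' : ℝ → H)
    (hu0 : u 0 = u₀) (hv0 : u' 0 = v₀)
    (hu : ∀ t ∈ Ici (0:ℝ), HasDerivWithinAt u (u' t) (Ici 0) t)
    (hu' : ∀ t ∈ Ici (0:ℝ), HasDerivWithinAt u' (u'' t) (Ici 0) t)
    (hu''cont : ContinuousOn u'' (Ici 0))
    (heq : ∀ t ∈ Ici (0:ℝ), u'' t + γ • u' t + φ' (u t) + A (u t) = 0) :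
    ∀ p ∈ S, IntegrableOn (fun s => ‖u'' s + φ' (u s) + A p‖ ^ 2) (Ici 0) := by
  intro p hp
  rw [hS, mem_ofPred_eq, add_eq_zero_iff_eq_neg] at hp
  have hacc (t : ℝ) (ht : t ∈ Ici (0 : ℝ)) :
      u'' t = -(γ • u' t + φ' (u t) + A (u t)) := by
    rw [eq_neg_iff_add_eq_zero, ← heq t ht]
    abel
  have hcont : ContinuousOn (fun s => ‖u'' s + φ' (u s) + A p‖ ^ 2) (Ici 0) := by
    have hu'c : ContinuousOn u' (Ici 0) := fun t ht => (hu' t ht).continuousWithinAt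
    have huc : ContinuousOn u (Ici 0) := fun t ht => (hu t ht).continuousWithinAt
    have hAu := (continuous_of_cocoercive hlam hAcoco).comp_continuousOn huc
    have h : ContinuousOn (fun s => ‖-(γ • u' s) - A (u s) + A p‖ ^ 2) (Ici 0) :=
      ((((hu'c.const_smul γ).neg.sub hAu).add continuousOn_const).norm).pow 2
    refine h.congr fun t ht => ?_
    simp only
    rw [hacc t ht]
    congr 2
    abel
  have hφu (t : ℝ) (ht : t ∈ Ici (0 : ℝ)) :
      HasDerivWithinAt (fun s => φ (u s)) ⟪φ' (u t), u' t⟫ (Ici 0) t := by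
    simpa [Function.comp_def] using (hφgrad (u t)).hasFDerivAt.comp_hasDerivWithinAt t (hu t ht)
  refine integrableOn_Ici_of_hasDerivWithinAt_le_neg hlam hcont (fun _ _ => by positivity)
    (G := fun t => ⟪u' t, u t - p⟫ + γ / 2 * ⟪u t - p, u t - p⟫ + γ * lam * ⟪u' t, u' t⟫ +
      2 * γ * lam * (φ (u t) + ⟪A p, u t - p⟫)) (m := 2 * γ * lam * φ p)
    (fun t ht => ((((hu' t ht).inner ℝ ((hu t ht).sub_const p)).add
      ((((hu t ht).sub_const p).inner ℝ ((hu t ht).sub_const p)).const_mul (γ / 2))).add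
      (((hu' t ht).inner ℝ (hu' t ht)).const_mul (γ * lam))).add
      (((hφu t ht).add ((hasDerivWithinAt_const t (Ici 0) (A p)).inner ℝ
        ((hu t ht).sub_const p))).const_mul (2 * γ * lam))) (fun t ht => ?_) (fun t ht => ?_)
  · have hmono : 0 ≤ ⟪φ' (u t) + A p, u t - p⟫ := by
      have h₁ := hφconv.add_inner_le_of_hasGradientAt (hφgrad (u t)) p
      have h₂ := hφconv.add_inner_le_of_hasGradientAt (hφgrad p) (u t)
      rw [hp, inner_neg_left] at h₂
      rw [← neg_sub (u t) p, inner_neg_right] at h₁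
      rw [inner_add_left]
      linarith
    have hco := hAcoco (u t) p
    have hv := mul_nonneg (sub_nonneg.2 hcond.le) (sq_nonneg ‖u' t‖)
    have hnorm : u'' t + φ' (u t) + A p = -(γ • u' t + (A (u t) - A p)) := by
      rw [hacc t ht]
      abel
    have hsplit : u'' t = -(γ • u' t + (φ' (u t) + A p) + (A (u t) - A p)) := by
      rw [hacc t ht]
      abel
    have hφ'u : ⟪φ' (u t), u' t⟫ = ⟪φ' (u t) + A p, u' t⟫ - ⟪A p, u' t⟫ := by
      rw [inner_add_left]
      ring
    rw [hnorm, norm_neg, norm_add_sq_real, norm_smul, mul_pow, Real.norm_eq_abs, sq_abs, hsplit,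
      hφ'u]
    generalize φ' (u t) + A p = w at *
    generalize A (u t) - A p = b at *
    generalize u t - p = x at *
    generalize u' t = v at *
    simp only [inner_neg_left, inner_neg_right, inner_add_left, inner_add_right,
      real_inner_smul_left, real_inner_smul_right, inner_zero_left, real_inner_self_eq_norm_sq,
      real_inner_comm x v, real_inner_comm w v, real_inner_comm b v] at *
    nlinarith
  · have hmin := hφconv.add_inner_le_of_hasGradientAt (hφgrad p) (u t)
    rw [hp, inner_neg_left] at hmin
    have hpot : 2 * γ * lam * φ p ≤ 2 * γ * lam * (φ (u t) + ⟪A p, u t - p⟫) :=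
      mul_le_mul_of_nonneg_left (by linarith) (by positivity)
    have hquad : 0 ≤ ⟪u' t, u t - p⟫ + γ / 2 * ⟪u t - p, u t - p⟫ +
        γ * lam * ⟪u' t, u' t⟫ := by
      have hsq := sq_nonneg ‖u' t + γ • (u t - p)‖
      have hv := mul_nonneg (sub_nonneg.2 hcond.le) (sq_nonneg ‖u' t‖)
      rw [norm_add_sq_real, norm_smul, mul_pow, Real.norm_eq_abs, sq_abs,
        real_inner_smul_right] at hsq
      rw [real_inner_self_eq_norm_sq, real_inner_self_eq_norm_sq]
      refine nonneg_of_mul_nonneg_right ?_ hγ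
      nlinarith [sq_nonneg ‖u' t‖]
    linarith
end

section
/- Let H be a real Hilbert space, φ : H → ℝ a convex differentiable function whose gradient ∇φ is Lipschitz continuous on bounded subsets of H, and A : H → H a maximal monotone operator that is λ-cocoercive for some λ > 0. Let γ > 0 satisfy λγ² > 1, and suppose S := (∇φ + A)⁻¹(0) is nonempty. Then for any initial data u₀, v₀ ∈ H, the solution u of ü(t) + γ u̇(t) + ∇φ(u(t)) + A(u(t)) = 0 with u(0) = u₀, u̇(0) = v₀ satisfies: for every p ∈ S, the limit lim_{t→+∞} |u(t) − p| exists. -/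
open Filter MeasureTheory Set Bornology
open scoped RealInnerProductSpace NNReal Topology

theorem antitoneOn_Ici_of_hasDerivWithinAt_nonpos {f f' : ℝ → ℝ} {a : ℝ}
    (hf : ∀ t ∈ Ici a, HasDerivWithinAt f (f' t) (Ici a) t) (hf' : ∀ t ∈ Ici a, f' t ≤ 0) :
    AntitoneOn f (Ici a) :=
  antitoneOn_of_hasDerivWithinAt_nonpos (convex_Ici a)
    (fun t ht => (hf t ht).continuousWithinAt)
    (fun t ht => (hf t (interior_subset ht)).mono interior_subset)
    (fun t ht => hf' t (interior_subset ht))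

theorem AntitoneOn.exists_tendsto_atTop_of_le {f : ℝ → ℝ} {a m : ℝ}
    (hf : AntitoneOn f (Ici a)) (hm : ∀ t ∈ Ici a, m ≤ f t) :
    ∃ L, Tendsto f atTop (𝓝 L) := by
  have hanti : Antitone fun t => f (max a t) := fun s t hst =>
    hf (le_max_left a s) (le_max_left a t) (max_le_max le_rfl hst)
  refine ⟨_, (tendsto_atTop_ciInf hanti ⟨m, ?_⟩).congr' ?_⟩
  · rintro _ ⟨t, rfl⟩
    exact hm _ (le_max_left a t)
  · filter_upwards [eventually_ge_atTop a] with t ht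
    rw [max_eq_right ht]

/-- A Grönwall-type upper bound: if `y' + γ y` is eventually below `γ c`, then `y` is eventually
below any `d > c`. -/
theorem eventually_lt_of_hasDerivWithinAt_add_mul_le {y y' : ℝ → ℝ} {γ c d : ℝ} (hγ : 0 < γ)
    (hy : ∀ t ∈ Ici (0 : ℝ), HasDerivWithinAt y (y' t) (Ici 0) t)
    (hle : ∀ᶠ t in atTop, y' t + γ * y t ≤ γ * c) (hcd : c < d) :
    ∀ᶠ t in atTop, y t < d := by
  obtain ⟨T, hT⟩ := eventually_atTop.1 (hle.and (eventually_ge_atTop 0))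
  have hanti : AntitoneOn (fun t => Real.exp (γ * t) * (y t - c)) (Ici T) := by
    refine antitoneOn_Ici_of_hasDerivWithinAt_nonpos
      (f' := fun t => Real.exp (γ * t) * (y' t + γ * y t - γ * c)) (fun t ht => ?_)
      (fun t ht => mul_nonpos_of_nonneg_of_nonpos (Real.exp_pos _).le
        (sub_nonpos.2 (hT t ht).1))
    have h1 : HasDerivWithinAt (fun t => Real.exp (γ * t)) (Real.exp (γ * t) * (γ * 1)) (Ici T) t :=
      (((hasDerivAt_id t).const_mul γ).exp).hasDerivWithinAt
    have h2 := ((hy t (hT t ht).2).mono (Ici_subset_Ici.2 (hT T le_rfl).2)).sub_const c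
    exact (h1.mul h2).congr_deriv (by ring)
  have hlim : Tendsto (fun t => Real.exp (γ * t) * (d - c)) atTop atTop :=
    (Real.tendsto_exp_atTop.comp (tendsto_id.const_mul_atTop hγ)).atTop_mul_const (sub_pos.2 hcd)
  filter_upwards [hlim.eventually_gt_atTop (Real.exp (γ * T) * (y T - c)),
    eventually_ge_atTop T] with t ht hTt
  have := (hanti self_mem_Ici hTt hTt).trans_lt ht
  linarith [lt_of_mul_lt_mul_left this (Real.exp_pos _).le]

/-- If `y' + γ y` converges to `γ L` with `γ > 0`, then `y` converges to `L`. -/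
theorem tendsto_of_tendsto_hasDerivWithinAt_add_mul {y y' : ℝ → ℝ} {γ L : ℝ} (hγ : 0 < γ)
    (hy : ∀ t ∈ Ici (0 : ℝ), HasDerivWithinAt y (y' t) (Ici 0) t)
    (hL : Tendsto (fun t => y' t + γ * y t) atTop (𝓝 (γ * L))) :
    Tendsto y atTop (𝓝 L) := by
  refine tendsto_order.2 ⟨fun a ha => ?_, fun b hb => ?_⟩
  · obtain ⟨c, hac, hcL⟩ := exists_between ha
    have hle : ∀ᶠ t in atTop, -y' t + γ * -y t ≤ γ * -c := by
      filter_upwards [hL.eventually_const_lt (mul_lt_mul_of_pos_left hcL hγ)] with t ht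
      linarith
    filter_upwards [eventually_lt_of_hasDerivWithinAt_add_mul_le hγ (fun t ht => (hy t ht).neg)
      hle (neg_lt_neg hac)] with t ht
    exact neg_lt_neg_iff.1 ht
  · obtain ⟨c, hLc, hcb⟩ := exists_between hb
    exact eventually_lt_of_hasDerivWithinAt_add_mul_le hγ hy
      ((hL.eventually_lt_const (mul_lt_mul_of_pos_left hLc hγ)).mono fun t ht => ht.le) hcb

/-- For every equilibrium `p ∈ S`, the limit of `‖u(t) − p‖` as `t → ∞` exists. -/
theorem distance_to_equilibrium_converges
    {H : Type*} [NormedAddCommGroup H] [InnerProductSpace ℝ H] [CompleteSpace H]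
    (φ : H → ℝ) (φ' : H → H) (A : H → H) (lam γ : ℝ)
    (hφconv : ConvexOn ℝ univ φ)
    (hφgrad : ∀ x, HasGradientAt φ (φ' x) x)
    (hφlip : ∀ s : Set H, IsBounded s → ∃ K : ℝ≥0, LipschitzOnWith K φ' s)
    (hAmono : ∀ v w : H, 0 ≤ ⟪A v - A w, v - w⟫)
    (hAmax : ∀ x y : H, (∀ v : H, 0 ≤ ⟪A v - y, v - x⟫) → y = A x)
    (hlam : 0 < lam)
    (hAcoco : ∀ v w : H, lam * ‖A v - A w‖ ^ 2 ≤ ⟪A v - A w, v - w⟫)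
    (hγ : 0 < γ) (hcond : 1 < lam * γ ^ 2)
    (S : Set H) (hS : S = {v : H | φ' v + A v = 0}) (hSne : S.Nonempty)
    (u₀ v₀ : H) (u u' u'' : ℝ → H)
    (hu0 : u 0 = u₀) (hv0 : u' 0 = v₀)
    (hu : ∀ t ∈ Ici (0:ℝ), HasDerivWithinAt u (u' t) (Ici 0) t)
    (hu' : ∀ t ∈ Ici (0:ℝ), HasDerivWithinAt u' (u'' t) (Ici 0) t)
    (hu''cont : ContinuousOn u'' (Ici 0))
    (heq : ∀ t ∈ Ici (0:ℝ), u'' t + γ • u' t + φ' (u t) + A (u t) = 0) :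
    ∀ p ∈ S, ∃ L : ℝ, Tendsto (fun t => ‖u t - p‖) atTop (𝓝 L) := by
  intro p hp
  have hp0 : φ' p + A p = 0 := by rwa [hS] at hp
  have hAp : A p = -φ' p := eq_neg_of_add_eq_zero_right hp0
  have hgrad x y : φ x + ⟪φ' x, y - x⟫ ≤ φ y := hφconv.add_inner_le_of_hasGradientAt (hφgrad x) y
  set V : ℝ → ℝ := fun t => ⟪u' t, u t - p⟫ with hV
  set W : ℝ → ℝ := fun t => ‖u t - p‖ ^ 2 / 2 with hW
  set V' : ℝ → ℝ := fun t => ⟪u'' t, u t - p⟫ + ‖u' t‖ ^ 2 with hV'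
  set F : ℝ → ℝ := fun t =>
    ‖u' t‖ ^ 2 / 2 + (φ (u t) - φ p - ⟪φ' p, u t - p⟫) + γ / 2 * (V t + γ * W t) with hF
  set F' : ℝ → ℝ := fun t =>
    ⟪u' t, u'' t⟫ + (⟪φ' (u t), u' t⟫ - ⟪φ' p, u' t⟫) + γ / 2 * (V' t + γ * V t) with hF'
  have hdw t (ht : t ∈ Ici (0 : ℝ)) : HasDerivWithinAt (fun t => u t - p) (u' t) (Ici 0) t :=
    (hu t ht).sub_const p
  have hdW t (ht : t ∈ Ici (0 : ℝ)) : HasDerivWithinAt W (V t) (Ici 0) t := by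
    refine ((hdw t ht).norm_sq.div_const 2).congr_deriv ?_
    simp only [hV, real_inner_comm (u' t)]
    ring
  have hdV t (ht : t ∈ Ici (0 : ℝ)) : HasDerivWithinAt V (V' t) (Ici 0) t := by
    refine ((hu' t ht).inner ℝ (hdw t ht)).congr_deriv ?_
    simp only [hV', real_inner_self_eq_norm_sq]
    ring
  have hdF t (ht : t ∈ Ici (0 : ℝ)) : HasDerivWithinAt F (F' t) (Ici 0) t := by
    have h1 : HasDerivWithinAt (fun t => ‖u' t‖ ^ 2 / 2) ⟪u' t, u'' t⟫ (Ici 0) t :=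
      ((hu' t ht).norm_sq.div_const 2).congr_deriv (by ring)
    have h2 : HasDerivWithinAt (fun t => φ (u t)) ⟪φ' (u t), u' t⟫ (Ici 0) t := by
      exact ((hφgrad (u t)).hasFDerivAt.comp_hasDerivWithinAt t (hu t ht)).congr_deriv (by simp)
    have h3 : HasDerivWithinAt (fun t => ⟪φ' p, u t - p⟫) ⟪φ' p, u' t⟫ (Ici 0) t := by
      simpa using (hasDerivWithinAt_const t (Ici 0) (φ' p)).inner ℝ (hdw t ht)
    exact (h1.add ((h2.sub_const _).sub h3)).add
      (((hdV t ht).add ((hdW t ht).const_mul γ)).const_mul (γ / 2))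
  obtain ⟨ε, hε, hεeq⟩ : ∃ ε : ℝ, 0 < ε ∧ 2 * (γ * lam) * ε = lam * γ ^ 2 - 1 :=
    ⟨(lam * γ ^ 2 - 1) / (2 * (γ * lam)), div_pos (by linarith) (by positivity), by field_simp⟩
  have hVW t (ht : t ∈ Ici (0 : ℝ)) :
      V' t + γ * V t + lam * ‖A (u t) - A p‖ ^ 2 ≤ ‖u' t‖ ^ 2 := by
    have h1 := congrArg (fun z => ⟪z, u t - p⟫) (heq t ht)
    have h2 := hgrad (u t) p
    have h3 := hgrad p (u t)
    have h4 := hAcoco (u t) p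
    rw [← neg_sub (u t) p, inner_neg_right] at h2
    simp only [inner_add_left, inner_smul_left, inner_zero_left, conj_trivial] at h1
    rw [inner_sub_left, hAp, inner_neg_left, ← hAp] at h4
    simp only [hV, hV']
    linarith
  have hF'le t (ht : t ∈ Ici (0 : ℝ)) : F' t ≤ -ε * ‖u' t‖ ^ 2 := by
    have h1 := congrArg (fun z => ⟪z, u' t⟫) (heq t ht)
    simp only [inner_add_left, inner_smul_left, inner_zero_left, conj_trivial,
      real_inner_self_eq_norm_sq] at h1
    have h2 : ⟪A (u t) - A p, u' t⟫ = ⟪A (u t), u' t⟫ + ⟪φ' p, u' t⟫ := by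
      rw [inner_sub_left, hAp, inner_neg_left, sub_neg_eq_add]
    have h3 : F' t = -γ * ‖u' t‖ ^ 2 - ⟪A (u t) - A p, u' t⟫ + γ / 2 * (V' t + γ * V t) := by
      simp only [hF']
      rw [real_inner_comm]
      linarith
    have h4 : 0 ≤ ‖(γ * lam) • (A (u t) - A p) + u' t‖ ^ 2 := sq_nonneg _
    rw [norm_add_sq_real, inner_smul_left, norm_smul, mul_pow, Real.norm_eq_abs, sq_abs,
      conj_trivial] at h4
    have hgl : 0 < γ * lam := mul_pos hγ hlam
    rw [h3]
    refine le_of_mul_le_mul_left ?_ hgl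
    have h5 := mul_le_mul_of_nonneg_left (hVW t ht) (by positivity : 0 ≤ γ * lam * (γ / 2))
    have h6 := congrArg (· * ‖u' t‖ ^ 2) hεeq
    linear_combination h4 / 2 + h5 + h6 / 2
  have hFge t : ‖u' t‖ ^ 2 / 4 ≤ F t := by
    have h1 : 0 ≤ ‖u' t + γ • (u t - p)‖ ^ 2 := sq_nonneg _
    rw [norm_add_sq_real, inner_smul_right, norm_smul, mul_pow, Real.norm_eq_abs, sq_abs] at h1
    have h2 := hgrad p (u t)
    simp only [hF, hV, hW]
    linarith
  have hVWge t : -(2 / γ * F t) ≤ V t + γ * W t := by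
    have h1 : 0 ≤ ‖u' t + γ • (u t - p)‖ ^ 2 := sq_nonneg _
    rw [norm_add_sq_real, inner_smul_right, norm_smul, mul_pow, Real.norm_eq_abs, sq_abs] at h1
    have h2 : γ * (2 / γ * F t) = 2 * F t := by field_simp
    refine le_of_mul_le_mul_left ?_ hγ
    have h3 := hFge t
    simp only [hV, hW]
    linarith
  obtain ⟨LF, hLF⟩ := (antitoneOn_Ici_of_hasDerivWithinAt_nonpos hdF fun t ht =>
    (hF'le t ht).trans (by nlinarith [sq_nonneg ‖u' t‖])).exists_tendsto_atTop_of_le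
      (m := 0) fun t _ => (by positivity : (0 : ℝ) ≤ ‖u' t‖ ^ 2 / 4).trans (hFge t)
  set C : ℝ := 1 / ε + 2 / γ with hC
  have hCε : 1 ≤ C * ε := by
    rw [hC, add_mul, one_div_mul_cancel hε.ne']
    exact le_add_of_nonneg_right (by positivity)
  obtain ⟨LG, hLG⟩ : ∃ L, Tendsto (fun t => V t + γ * W t + C * F t) atTop (𝓝 L) := by
    refine (antitoneOn_Ici_of_hasDerivWithinAt_nonpos (a := 0) (fun t ht =>
      ((hdV t ht).add ((hdW t ht).const_mul γ)).add ((hdF t ht).const_mul C))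
      fun t ht => ?_).exists_tendsto_atTop_of_le (m := 0) fun t _ => ?_
    · have h1 := mul_le_mul_of_nonneg_left (hF'le t ht) (by positivity : 0 ≤ C)
      have h2 := mul_le_mul_of_nonneg_right hCε (sq_nonneg ‖u' t‖)
      have h3 := hVW t ht
      have h4 : 0 ≤ lam * ‖A (u t) - A p‖ ^ 2 := by positivity
      linarith
    · have h1 : 0 ≤ 1 / ε * F t :=
        mul_nonneg (by positivity) ((by positivity : (0 : ℝ) ≤ ‖u' t‖ ^ 2 / 4).trans (hFge t))
      have h2 := hVWge t
      rw [hC, add_mul]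
      linarith
  have hlim : Tendsto (fun t => V t + γ * W t) atTop (𝓝 (γ * ((LG - C * LF) / γ))) := by
    rw [mul_div_cancel₀ _ hγ.ne']
    simpa using hLG.sub (hLF.const_mul C)
  have hWlim := tendsto_of_tendsto_hasDerivWithinAt_add_mul hγ hdW hlim
  refine ⟨_, (hWlim.const_mul 2).sqrt.congr fun t => ?_⟩
  rw [hW, mul_div_cancel₀ _ two_ne_zero, Real.sqrt_sq (norm_nonneg _)]
end

section
/- Let H be a real Hilbert space, Φ : H → ℝ ∪ {+∞} a convex lower semicontinuous function, (uₙ) a bounded sequence in H, and p ∈ H. If there exist ηₙ ∈ ∂Φ(uₙ) for each n and η̄ ∈ ∂Φ(p) such that lim_{n→∞} ⟨uₙ − p, ηₙ − η̄⟩ = 0, then every weak cluster point ū of the sequence (uₙ) satisfies η̄ ∈ ∂Φ(ū). -/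
open Filter Set Bornology
open scoped RealInnerProductSpace Topology

/-- A convex lower semicontinuous function which takes the value `⊥` is constantly `⊥`. -/
theorem eq_bot_of_convex_of_lowerSemicontinuous
    {E : Type*} [NormedAddCommGroup E] [NormedSpace ℝ E] {Φ : E → EReal}
    (hconv : ∀ x y : E, ∀ a b : ℝ, 0 ≤ a → 0 ≤ b → a + b = 1 →
      Φ (a • x + b • y) ≤ (a : EReal) * Φ x + (b : EReal) * Φ y)
    (hlsc : LowerSemicontinuous Φ) {x : E} (hx : Φ x = ⊥) (y : E) : Φ y = ⊥ := by
  by_contra hy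
  have hcont : Tendsto (fun t : ℝ => t • x + (1 - t) • y) (𝓝[>] 0) (𝓝 y) := by
    have h : Continuous (fun t : ℝ => t • x + (1 - t) • y) := by fun_prop
    simpa using (h.tendsto 0).mono_left nhdsWithin_le_nhds
  have hpos := hcont.eventually (hlsc y ⊥ (bot_lt_iff_ne_bot.2 hy))
  obtain ⟨t, ht, ht0, ht1⟩ := (hpos.and (Ioo_mem_nhdsGT zero_lt_one)).exists
  have hle := hconv x y t (1 - t) ht0.le (by linarith) (by ring)
  rw [hx, EReal.coe_mul_bot_of_pos ht0, EReal.bot_add] at hle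
  exact absurd ht (not_lt.2 hle)

/-- The set where a convex function lies below a continuous affine one is convex. -/
theorem convex_setOf_le_affine
    {E : Type*} [NormedAddCommGroup E] [NormedSpace ℝ E] {Φ : E → EReal}
    (hconv : ∀ x y : E, ∀ a b : ℝ, 0 ≤ a → 0 ≤ b → a + b = 1 →
      Φ (a • x + b • y) ≤ (a : EReal) * Φ x + (b : EReal) * Φ y)
    (l : E →L[ℝ] ℝ) (c : ℝ) : Convex ℝ {x | Φ x ≤ ((l x + c : ℝ) : EReal)} := by
  intro x hx y hy a b ha hb hab
  calc Φ (a • x + b • y) ≤ (a : EReal) * Φ x + (b : EReal) * Φ y := hconv x y a b ha hb hab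
    _ ≤ (a : EReal) * ((l x + c : ℝ) : EReal) + (b : EReal) * ((l y + c : ℝ) : EReal) :=
      add_le_add (mul_le_mul_of_nonneg_left hx (EReal.coe_nonneg.2 ha))
        (mul_le_mul_of_nonneg_left hy (EReal.coe_nonneg.2 hb))
    _ = ((l (a • x + b • y) + c : ℝ) : EReal) := by
      rw [← EReal.coe_mul, ← EReal.coe_mul, ← EReal.coe_add]
      congr 1
      simp only [map_add, map_smul, smul_eq_mul]
      linear_combination c * hab

/-- The set where a lower semicontinuous function lies below a continuous affine one is closed. -/
theorem isClosed_setOf_le_affine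
    {E : Type*} [NormedAddCommGroup E] [NormedSpace ℝ E] {Φ : E → EReal}
    (hlsc : LowerSemicontinuous Φ)
    (l : E →L[ℝ] ℝ) (c : ℝ) : IsClosed {x | Φ x ≤ ((l x + c : ℝ) : EReal)} := by
  have h : Continuous (fun x : E => (x, ((l x + c : ℝ) : EReal))) :=
    continuous_id.prodMk (continuous_coe_real_ereal.comp (by fun_prop))
  exact hlsc.isClosed_epigraph.preimage h

/-- A closed convex set contains the weak limits of its sequences. -/
theorem Convex.mem_of_tendsto_dual
    {E : Type*} [NormedAddCommGroup E] [NormedSpace ℝ E] {s : Set E}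
    (hs : Convex ℝ s) (hclosed : IsClosed s) {w : ℕ → E} {x : E}
    (hw : ∀ f : E →L[ℝ] ℝ, Tendsto (fun k => f (w k)) atTop (𝓝 (f x)))
    (hmem : ∀ᶠ k in atTop, w k ∈ s) : x ∈ s := by
  by_contra hx
  obtain ⟨f, r, hr, hsr⟩ := geometric_hahn_banach_point_closed hs hclosed hx
  exact absurd hr (not_lt.2 (ge_of_tendsto (hw f) (hmem.mono fun k hk => (hsr _ hk).le)))

/-- Let `Φ : H → ℝ ∪ {+∞}` be convex and lower semicontinuous, `(uₙ)` a bounded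
sequence, `p ∈ H`, `ηₙ ∈ ∂Φ(uₙ)` and `η̄ ∈ ∂Φ(p)` with `⟪uₙ − p, ηₙ − η̄⟫ → 0`.  Then every weak
cluster point `ū` of `(uₙ)` satisfies `η̄ ∈ ∂Φ(ū)`. -/
theorem subdifferential_of_weak_cluster_point
    {H : Type*} [NormedAddCommGroup H] [InnerProductSpace ℝ H] [CompleteSpace H]
    (Φ : H → EReal)
    (hconv : ∀ x y : H, ∀ a b : ℝ, 0 ≤ a → 0 ≤ b → a + b = 1 →
      Φ (a • x + b • y) ≤ (a : EReal) * Φ x + (b : EReal) * Φ y)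
    (hlsc : LowerSemicontinuous Φ)
    (u : ℕ → H) (hbdd : IsBounded (range u))
    (p : H) (η : ℕ → H) (ηbar : H)
    (hη : ∀ n, ∀ v : H, Φ (u n) + (⟪η n, v - u n⟫ : EReal) ≤ Φ v)
    (hηbar : ∀ v : H, Φ p + (⟪ηbar, v - p⟫ : EReal) ≤ Φ v)
    (hlim : Tendsto (fun n => ⟪u n - p, η n - ηbar⟫) atTop (𝓝 0)) :
    ∀ ubar : H,
      (∃ ψ : ℕ → ℕ, StrictMono ψ ∧
        ∀ f : H →L[ℝ] ℝ, Tendsto (fun k => f (u (ψ k))) atTop (𝓝 (f ubar))) →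
      ∀ v : H, Φ ubar + (⟪ηbar, v - ubar⟫ : EReal) ≤ Φ v := by
  rintro ubar ⟨ψ, hψ, hweak⟩ v
  by_cases hbot : ∃ x, Φ x = ⊥
  · obtain ⟨x, hx⟩ := hbot
    rw [eq_bot_of_convex_of_lowerSemicontinuous hconv hlsc hx ubar, EReal.bot_add]
    exact bot_le
  by_cases hv : Φ v = ⊤
  · rw [hv]
    exact le_top
  have hne_bot : ∀ x, Φ x ≠ ⊥ := fun x hx => hbot ⟨x, hx⟩
  have hp : Φ p ≠ ⊤ := by
    intro h
    have h' := hηbar v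
    rw [h, EReal.top_add_coe] at h'
    exact hv (top_le_iff.1 h')
  have hu : ∀ n, Φ (u n) ≠ ⊤ := by
    intro n h
    have h' := hη n v
    rw [h, EReal.top_add_coe] at h'
    exact hv (top_le_iff.1 h')
  have hη_p := fun n => hη n p
  have hηbar_v := hηbar v
  lift Φ p to ℝ using ⟨hp, hne_bot p⟩ with a
  lift Φ v to ℝ using ⟨hv, hne_bot v⟩ with b
  have hupper : ∀ ε : ℝ, 0 < ε →
      Φ ubar ≤ ((innerSL ℝ ηbar ubar + (a - ⟪ηbar, p⟫ + ε) : ℝ) : EReal) := by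
    intro ε hε
    refine (convex_setOf_le_affine hconv (innerSL ℝ ηbar) _).mem_of_tendsto_dual
      (isClosed_setOf_le_affine hlsc _ _) hweak ?_
    filter_upwards [(hlim.comp hψ.tendsto_atTop).eventually (gt_mem_nhds hε)] with k hk
    have h := hη_p (ψ k)
    simp only [Function.comp_apply] at hk
    lift Φ (u (ψ k)) to ℝ using ⟨hu _, hne_bot _⟩ with d
    norm_cast at h ⊢
    simp only [inner_sub_right, innerSL_apply_apply,
      real_inner_comm (η (ψ k)), real_inner_comm ηbar] at h hk ⊢
    linarith
  have hubar : Φ ubar ≠ ⊤ := ((hupper 1 one_pos).trans_lt (EReal.coe_lt_top _)).ne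
  lift Φ ubar to ℝ using ⟨hubar, hne_bot ubar⟩ with c
  norm_cast at hupper hηbar_v ⊢
  simp only [inner_sub_right, innerSL_apply_apply] at hupper hηbar_v ⊢
  refine le_of_forall_pos_le_add fun ε hε => ?_
  linarith [hupper ε hε]
end

section
/- Let H be a real Hilbert space, A : H → H a maximal monotone single-valued operator, and φ : H → ℝ a convex differentiable function such that S := (∇φ + A)⁻¹(0) is nonempty. Suppose p ∈ S and (uₙ) is a bounded sequence in H such that (c1) lim_{n→∞} ⟨∇φ(uₙ) − ∇φ(p), uₙ − p⟩ = 0 and (c2) lim_{n→∞} |A uₙ − A p| = 0. Then every weak cluster point of (uₙ) belongs to S. -/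
open Filter Set Bornology
open scoped RealInnerProductSpace Topology

/-- The gradient inequality for a convex function on a real Hilbert space. -/
theorem ConvexOn.add_inner_gradient_le
    {H : Type*} [NormedAddCommGroup H] [InnerProductSpace ℝ H] [CompleteSpace H]
    {φ : H → ℝ} (hφ : ConvexOn ℝ univ φ) {w g : H} (hg : HasGradientAt φ g w) (v : H) :
    φ w + ⟪g, v - w⟫ ≤ φ v := by
  have hconv : ConvexOn ℝ univ (fun t : ℝ => φ (AffineMap.lineMap w v t)) := by
    simpa using! hφ.comp_affineMap (AffineMap.lineMap (k := ℝ) w v)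
  have hderiv : HasDerivAt (fun t : ℝ => φ (AffineMap.lineMap w v t)) ⟪g, v - w⟫ 0 := by
    have hline : HasDerivAt (fun t : ℝ => AffineMap.lineMap w v t) (v - w) (0 : ℝ) :=
      AffineMap.hasDerivAt_lineMap
    have hφw : HasFDerivAt φ (InnerProductSpace.toDual ℝ H g)
        (AffineMap.lineMap w v (0 : ℝ)) := by
      simpa using hg.hasFDerivAt
    simpa using! hφw.comp_hasDerivAt (0 : ℝ) hline
  have h := hconv.le_slope_of_hasDerivAt (mem_univ 0) (mem_univ 1) one_pos hderiv
  simp only [slope_def_field, AffineMap.lineMap_apply_one, AffineMap.lineMap_apply_zero] at h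
  linarith

/-- A point of global minimum of `φ - ⟪g, ·⟫` is a point where the gradient of `φ` is `g`. -/
theorem HasGradientAt.eq_of_forall_sub_inner_le
    {H : Type*} [NormedAddCommGroup H] [InnerProductSpace ℝ H] [CompleteSpace H]
    {φ : H → ℝ} {x g g' : H} (hg' : HasGradientAt φ g' x)
    (hmin : ∀ v, φ x - ⟪g, x⟫ ≤ φ v - ⟪g, v⟫) : g' = g := by
  have hloc : IsLocalMin (fun v => φ v - InnerProductSpace.toDual ℝ H g v) x :=
    Eventually.of_forall fun v => by simpa using hmin v
  have h := hloc.hasFDerivAt_eq_zero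
    (hg'.hasFDerivAt.sub (InnerProductSpace.toDual ℝ H g).hasFDerivAt)
  exact (InnerProductSpace.toDual ℝ H).injective (sub_eq_zero.mp h)

/-- If `p ∈ S := (∇φ + A)⁻¹(0)` and `(uₙ)` is a bounded sequence with
`⟪∇φ(uₙ) − ∇φ(p), uₙ − p⟫ → 0` and `‖A uₙ − A p‖ → 0`, then every weak cluster point of `(uₙ)`
belongs to `S`. -/
theorem weak_cluster_points_are_equilibria
    {H : Type*} [NormedAddCommGroup H] [InnerProductSpace ℝ H] [CompleteSpace H]
    (A : H → H) (φ : H → ℝ) (φ' : H → H)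
    (hAmono : ∀ v w : H, 0 ≤ ⟪A v - A w, v - w⟫)
    (hAmax : ∀ x y : H, (∀ v : H, 0 ≤ ⟪A v - y, v - x⟫) → y = A x)
    (hφconv : ConvexOn ℝ univ φ)
    (hφgrad : ∀ x, HasGradientAt φ (φ' x) x)
    (S : Set H) (hS : S = {v : H | φ' v + A v = 0}) (hSne : S.Nonempty)
    (p : H) (hp : p ∈ S)
    (u : ℕ → H) (hbdd : IsBounded (range u))
    (hc1 : Tendsto (fun n => ⟪φ' (u n) - φ' p, u n - p⟫) atTop (𝓝 0))
    (hc2 : Tendsto (fun n => ‖A (u n) - A p‖) atTop (𝓝 0)) :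
    ∀ ubar : H,
      (∃ ψ : ℕ → ℕ, StrictMono ψ ∧
        ∀ f : H →L[ℝ] ℝ, Tendsto (fun k => f (u (ψ k))) atTop (𝓝 (f ubar))) →
      ubar ∈ S := by
  rintro ubar ⟨ψ, hψ, hweak⟩
  have hinner (a : H) : Tendsto (fun k => ⟪a, u (ψ k)⟫) atTop (𝓝 ⟪a, ubar⟫) := by
    simpa using hweak (InnerProductSpace.toDual ℝ H a)
  rw [hS, mem_ofPred_eq] at hp ⊢
  have hA : A p = A ubar := by
    refine hAmax ubar (A p) fun v => ?_
    obtain ⟨C, hC⟩ := hbdd.exists_norm_le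
    have hcross : Tendsto (fun k => ⟪A (u (ψ k)) - A p, v - u (ψ k)⟫) atTop (𝓝 0) := by
      have hzero : Tendsto (fun k => ‖A (u (ψ k)) - A p‖ * (‖v‖ + C)) atTop (𝓝 0) := by
        simpa using (hc2.comp hψ.tendsto_atTop).mul_const (‖v‖ + C)
      refine squeeze_zero_norm (fun k => (norm_inner_le_norm _ _).trans ?_) hzero
      gcongr
      exact (norm_sub_le _ _).trans (by gcongr; exact hC _ (mem_range_self _))
    have hlim : Tendsto (fun k => ⟪A v - A (u (ψ k)), v - u (ψ k)⟫) atTop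
        (𝓝 ⟪A v - A p, v - ubar⟫) := by
      have h := ((hinner (A v - A p)).const_sub ⟪A v - A p, v⟫).sub hcross
      rw [sub_zero, ← inner_sub_right] at h
      refine h.congr fun k => ?_
      rw [← inner_sub_right, ← inner_sub_left, sub_sub_sub_cancel_right]
    exact ge_of_tendsto' hlim fun k => hAmono _ _
  have hle : φ ubar - ⟪φ' p, ubar⟫ ≤ φ p - ⟪φ' p, p⟫ := by
    have hleft : Tendsto (fun k => φ ubar + (⟪φ' ubar - φ' p, u (ψ k)⟫ -
        ⟪φ' ubar - φ' p, ubar⟫) - ⟪φ' p, ubar⟫) atTop (𝓝 (φ ubar - ⟪φ' p, ubar⟫)) := by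
      simpa using (((hinner (φ' ubar - φ' p)).sub_const
        ⟪φ' ubar - φ' p, ubar⟫).const_add (φ ubar)).sub_const ⟪φ' p, ubar⟫
    have hright : Tendsto (fun k => φ p - ⟪φ' p, p⟫ +
        ⟪φ' (u (ψ k)) - φ' p, u (ψ k) - p⟫) atTop (𝓝 (φ p - ⟪φ' p, p⟫)) := by
      simpa using (hc1.comp hψ.tendsto_atTop).const_add (φ p - ⟪φ' p, p⟫)
    refine le_of_tendsto_of_tendsto' hleft hright fun k => ?_
    have h₁ := hφconv.add_inner_gradient_le (hφgrad ubar) (u (ψ k))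
    have h₂ := hφconv.add_inner_gradient_le (hφgrad (u (ψ k))) p
    simp only [inner_sub_left, inner_sub_right] at h₁ h₂ ⊢
    linarith
  have hgrad : φ' ubar = φ' p := by
    refine (hφgrad ubar).eq_of_forall_sub_inner_le fun v => hle.trans ?_
    have h := hφconv.add_inner_gradient_le (hφgrad p) v
    rw [inner_sub_right] at h
    linarith
  rw [hgrad, ← hA, hp]
end

section
/- Let w ∈ C²([0,∞); ℝ) be bounded from below and satisfy ẅ(t) + γ ẇ(t) ≤ g(t) for all t ≥ 0, where γ is a positive constant and g ∈ L¹([0,∞); ℝ). Then w(t) converges to a finite limit as t → +∞. -/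
open Filter MeasureTheory Set
open scoped Topology

/-- If `z' + γ z ≤ γ c` eventually and `c < b`, then `z < b` eventually. -/
theorem eventually_lt_of_deriv_add_mul_le
    {z z' : ℝ → ℝ} {γ b c : ℝ} (hγ : 0 < γ)
    (hz : ∀ t ∈ Ici (0:ℝ), HasDerivWithinAt z (z' t) (Ici 0) t)
    (hle : ∀ᶠ t in atTop, z' t + γ * z t ≤ γ * c) (hcb : c < b) :
    ∀ᶠ t in atTop, z t < b := by
  obtain ⟨T, hT⟩ := eventually_atTop.1 (hle.and (eventually_ge_atTop (0:ℝ)))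
  have hT0 : 0 ≤ T := (hT T le_rfl).2
  have hsub : Ici T ⊆ Ici (0:ℝ) := Ici_subset_Ici.2 hT0
  have hd : ∀ t ∈ Ici T, HasDerivWithinAt (fun t => Real.exp (γ * t) * (z t - c))
      (Real.exp (γ * t) * γ * (z t - c) + Real.exp (γ * t) * z' t) (Ici T) t := by
    intro t ht
    have h := ((hasDerivAt_id t).const_mul γ).exp.hasDerivWithinAt (s := Ici T)
    simp only [id, mul_one] at h
    exact h.mul (((hz t (hsub ht)).mono hsub).sub_const c)
  have hanti : AntitoneOn (fun t => Real.exp (γ * t) * (z t - c)) (Ici T) := by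
    refine antitoneOn_of_hasDerivWithinAt_nonpos (convex_Ici T)
      (fun t ht => (hd t ht).continuousWithinAt)
      (fun t ht => (hd t (interior_subset ht)).mono interior_subset) fun t ht => ?_
    have h := (hT t (interior_subset ht)).1
    have := mul_nonneg (Real.exp_pos (γ * t)).le (sub_nonneg.2 h)
    linarith
  have hlim : Tendsto (fun t => Real.exp (γ * t) * (b - c)) atTop atTop :=
    (Real.tendsto_exp_atTop.comp (tendsto_id.const_mul_atTop hγ)).atTop_mul_const
      (sub_pos.2 hcb)
  filter_upwards [hlim.eventually_gt_atTop (Real.exp (γ * T) * (z T - c)),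
    eventually_ge_atTop T] with t ht htT
  have h := (hanti self_mem_Ici htT htT).trans_lt ht
  have := lt_of_mul_lt_mul_left h (Real.exp_pos _).le
  linarith

/-- If `z' + γ z` tends to `l` with `γ > 0`, then `z` tends to `l / γ`. -/
theorem tendsto_div_of_tendsto_deriv_add_mul
    {z z' : ℝ → ℝ} {γ l : ℝ} (hγ : 0 < γ)
    (hz : ∀ t ∈ Ici (0:ℝ), HasDerivWithinAt z (z' t) (Ici 0) t)
    (hl : Tendsto (fun t => z' t + γ * z t) atTop (𝓝 l)) :
    Tendsto z atTop (𝓝 (l / γ)) := by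
  refine tendsto_order.2 ⟨fun a ha => ?_, fun b hb => ?_⟩
  · obtain ⟨c, hac, hc⟩ := exists_between ha
    have h : ∀ᶠ t in atTop, -z' t + γ * -z t ≤ γ * -c := by
      filter_upwards [hl.eventually_const_lt ((lt_div_iff₀' hγ).1 hc)] with t ht
      linarith
    filter_upwards [eventually_lt_of_deriv_add_mul_le hγ
      (fun t ht => (hz t ht).fun_neg) h (neg_lt_neg hac)] with t ht
    exact neg_lt_neg_iff.1 ht
  · obtain ⟨c, hc, hcb⟩ := exists_between hb
    exact eventually_lt_of_deriv_add_mul_le hγ hz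
      ((hl.eventually_lt_const ((div_lt_iff₀' hγ).1 hc)).mono fun _ h => h.le) hcb

/-- A function on `[0,∞)` whose derivative is at most an integrable function converges in
`[-∞, ∞)`. -/
theorem tendsto_atBot_or_nhds_of_deriv_le_integrable
    {u u' g : ℝ → ℝ} (hu : ∀ t ∈ Ici (0:ℝ), HasDerivWithinAt u (u' t) (Ici 0) t)
    (hle : ∀ t ∈ Ici (0:ℝ), u' t ≤ g t) (hg : IntegrableOn g (Ici 0)) :
    Tendsto u atTop atBot ∨ ∃ l, Tendsto u atTop (𝓝 l) := by
  have hint : ∀ s t, 0 ≤ s → 0 ≤ t → IntervalIntegrable g volume s t := fun s t hs ht =>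
    (hg.mono_set (ordConnected_Ici.uIcc_subset hs ht)).intervalIntegrable
  have hanti : Antitone (fun t => u (max t 0) - ∫ x in (0:ℝ)..max t 0, g x) := by
    intro s t hst
    have hs : 0 ≤ max s 0 := le_max_right _ _
    have hst' : max s 0 ≤ max t 0 := max_le_max_right 0 hst
    have hsub : Icc (max s 0) (max t 0) ⊆ Ici 0 := fun x hx => hs.trans hx.1
    have h := intervalIntegral.sub_le_integral_of_hasDeriv_right_of_le hst'
      (fun x hx => ((hu x (hsub hx)).mono hsub).continuousWithinAt)
      (fun x hx => (hu x (hs.trans hx.1.le)).mono fun y hy =>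
        (hs.trans hx.1.le).trans (le_of_lt hy))
      (hg.mono_set hsub) (fun x hx => hle x (hs.trans hx.1.le))
    have h2 := intervalIntegral.integral_add_adjacent_intervals
      (hint 0 _ le_rfl hs) (hint _ _ hs (hs.trans hst'))
    dsimp only
    linarith
  have hG := intervalIntegral_tendsto_integral_Ioi 0 (hg.mono_set Ioi_subset_Ici_self) tendsto_id
  have heq : (fun t => (u (max t 0) - ∫ x in (0:ℝ)..max t 0, g x) + ∫ x in (0:ℝ)..id t, g x)
      =ᶠ[atTop] u := by
    filter_upwards [eventually_ge_atTop (0:ℝ)] with t ht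
    simp [max_eq_left ht]
  rcases tendsto_atTop_of_antitone hanti with h | ⟨l, h⟩
  · exact .inl ((h.atBot_add hG).congr' heq)
  · exact .inr ⟨_, (h.add hG).congr' heq⟩

/-- If `w ∈ C²([0,∞); ℝ)` is bounded from below and satisfies
`ẅ(t) + γẇ(t) ≤ g(t)` with `γ > 0` and `g ∈ L¹([0,∞))`, then `w(t)` converges as `t → ∞`. -/
theorem bounded_below_second_order_inequality_converges
    (w w' w'' g : ℝ → ℝ) (γ : ℝ) (hγ : 0 < γ)
    (hw : ∀ t ∈ Ici (0:ℝ), HasDerivWithinAt w (w' t) (Ici 0) t)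
    (hw' : ∀ t ∈ Ici (0:ℝ), HasDerivWithinAt w' (w'' t) (Ici 0) t)
    (hw''cont : ContinuousOn w'' (Ici 0))
    (hbdd : ∃ m : ℝ, ∀ t ∈ Ici (0:ℝ), m ≤ w t)
    (hineq : ∀ t ∈ Ici (0:ℝ), w'' t + γ * w' t ≤ g t)
    (hg : IntegrableOn g (Ici 0)) :
    ∃ L : ℝ, Tendsto w atTop (𝓝 L) := by
  rcases tendsto_atBot_or_nhds_of_deriv_le_integrable (u := fun t => w' t + γ * w t)
    (fun t ht => (hw' t ht).fun_add ((hw t ht).const_mul γ)) hineq hg with h | ⟨l, h⟩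
  · obtain ⟨m, hm⟩ := hbdd
    have hlt := eventually_lt_of_deriv_add_mul_le hγ hw
      (h.eventually_le_atBot (γ * (m - 1))) (sub_one_lt m)
    obtain ⟨t, ht, ht0⟩ := (hlt.and (eventually_ge_atTop 0)).exists
    exact absurd (hm t ht0) ht.not_ge
  · exact ⟨_, tendsto_div_of_tendsto_deriv_add_mul hγ hw h⟩
end

section
/- Let H be a real Hilbert space, A : H → 2^H a maximal monotone operator with S := A⁻¹(0) nonempty, and let γ > 0, λ > 0 satisfy λγ² > 1. Then for any initial data u₀, v₀ ∈ H, the unique solution u ∈ C²([0,∞); H) of ü(t) + γ u̇(t) + A_λ(u(t)) = 0 with u(0) = u₀, u̇(0) = v₀, where A_λ is the Yosida approximation of A of index λ, satisfies: (i) there exists u_∞ ∈ S such that u(t) converges weakly to u_∞ as t → +∞; (ii) ∫₀^∞ |u̇(s)|² ds < ∞ and |u̇(t)| → 0 as t → +∞. -/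
open Filter MeasureTheory Set
open scoped RealInnerProductSpace Topology

section WeakConvergence

variable {H : Type*} [NormedAddCommGroup H] [InnerProductSpace ℝ H] [CompleteSpace H]

/-- A bounded family in a Hilbert space converges weakly along every ultrafilter. -/
lemma exists_tendsto_inner_of_ultrafilter {ι : Type*} (U : Ultrafilter ι) {u : ι → H} {R : ℝ}
    (hR : ∀ᶠ t in (U : Filter ι), ‖u t‖ ≤ R) :
    ∃ x : H, ∀ y, Tendsto (fun t => ⟪u t, y⟫) U (𝓝 ⟪x, y⟫) := by
  let φ : ι → WeakDual ℝ H := fun t => StrongDual.toWeakDual (InnerProductSpace.toDual ℝ H (u t))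
  have hK := WeakDual.isCompact_closedBall (𝕜 := ℝ) (E := H) 0 R
  obtain ⟨f, -, hf⟩ := hK.ultrafilter_le_nhds (U.map φ) (by
    rw [Ultrafilter.coe_map, le_principal_iff, mem_map]
    filter_upwards [hR] with t ht
    simpa [φ] using ht)
  refine ⟨(InnerProductSpace.toDual ℝ H).symm (WeakDual.toStrongDual f), fun y => ?_⟩
  have h := ((WeakDual.eval_continuous y).tendsto f).comp
    (show Tendsto φ U (𝓝 f) from hf)
  simpa [φ, Function.comp_def] using h

/-- **Opial's lemma** for families indexed by a filter. -/
lemma opial_of_filter {ι : Type*} {l : Filter ι} [l.NeBot] {u : ι → H} {S : Set H} {R : ℝ}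
    (hR : ∀ᶠ t in l, ‖u t‖ ≤ R)
    (hlim : ∀ z ∈ S, ∃ L : ℝ, Tendsto (fun t => ‖u t - z‖ ^ 2) l (𝓝 L))
    (hS : ∀ (U : Ultrafilter ι) (x : H), (U : Filter ι) ≤ l →
      (∀ y, Tendsto (fun t => ⟪u t, y⟫) U (𝓝 ⟪x, y⟫)) → x ∈ S) :
    ∃ x ∈ S, ∀ y, Tendsto (fun t => ⟪u t, y⟫) l (𝓝 ⟪x, y⟫) := by
  obtain ⟨x, hx⟩ := exists_tendsto_inner_of_ultrafilter (Ultrafilter.of l)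
    (hR.filter_mono (Ultrafilter.of_le l))
  have hxS := hS _ x (Ultrafilter.of_le l) hx
  refine ⟨x, hxS, fun y => ?_⟩
  rw [tendsto_iff_ultrafilter]
  intro V hV
  obtain ⟨x', hx'⟩ := exists_tendsto_inner_of_ultrafilter V (hR.filter_mono hV)
  have hx'S := hS V x' hV hx'
  obtain ⟨L, hL⟩ := hlim x hxS
  obtain ⟨L', hL'⟩ := hlim x' hx'S
  have hd : Tendsto (fun t => ⟪u t, x - x'⟫) l
      (𝓝 ((L' - L + (‖x‖ ^ 2 - ‖x'‖ ^ 2)) / 2)) := by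
    refine (((hL'.sub hL).add_const _).div_const 2).congr fun t => ?_
    rw [norm_sub_sq_real, norm_sub_sq_real, inner_sub_right]
    ring
  have h1 := tendsto_nhds_unique (hx (x - x')) (hd.mono_left (Ultrafilter.of_le l))
  have h2 := tendsto_nhds_unique (hx' (x - x')) (hd.mono_left hV)
  have h3 : x - x' = 0 := by
    rw [← inner_self_eq_zero (𝕜 := ℝ), inner_sub_left, h1, h2, sub_self]
  rw [sub_eq_zero.1 h3]
  exact hx' y

end WeakConvergence

section Dynamics

variable {H : Type*} [NormedAddCommGroup H] [InnerProductSpace ℝ H]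

/-- A solution on `[0, ∞)` of `h' + γ h ≤ C` is bounded above. -/
lemma bddAbove_of_deriv_add_mul_le {h h' : ℝ → ℝ} {γ C : ℝ} (hγ : 0 < γ)
    (hh : ∀ t ∈ Ici (0 : ℝ), HasDerivWithinAt h (h' t) (Ici 0) t)
    (hC : ∀ t ∈ Ici (0 : ℝ), h' t + γ * h t ≤ C) :
    ∃ M, ∀ t ∈ Ici (0 : ℝ), h t ≤ M := by
  refine ⟨C / γ + |h 0 - C / γ|, fun t ht => ?_⟩
  have hw : ∀ s ∈ Ici (0 : ℝ), HasDerivWithinAt (fun s => Real.exp (γ * s) * (h s - C / γ))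
      (Real.exp (γ * s) * (h' s + γ * h s - C)) (Ici 0) s := by
    intro s hs
    have he : HasDerivWithinAt (fun s => Real.exp (γ * s)) (Real.exp (γ * s) * (γ * 1)) (Ici 0) s :=
      (((hasDerivAt_id s).const_mul γ).exp).hasDerivWithinAt
    refine (he.mul ((hh s hs).sub_const (C / γ))).congr_deriv ?_
    field_simp
    ring
  have hanti : AntitoneOn (fun s => Real.exp (γ * s) * (h s - C / γ)) (Ici 0) := by
    refine antitoneOn_of_hasDerivWithinAt_nonpos (convex_Ici 0)
      (fun s hs => (hw s hs).continuousWithinAt)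
      (fun s hs => (hw s (interior_subset hs)).mono interior_subset) fun s hs => ?_
    have := hC s (interior_subset hs)
    exact mul_nonpos_of_nonneg_of_nonpos (Real.exp_pos _).le (by linarith)
  have h1 := hanti self_mem_Ici ht ht
  simp only [mul_zero, Real.exp_zero, one_mul] at h1
  have h2 : 1 ≤ Real.exp (γ * t) := Real.one_le_exp (mul_nonneg hγ.le ht)
  have h3 := le_abs_self (h 0 - C / γ)
  have h4 := abs_nonneg (h 0 - C / γ)
  nlinarith

variable {B : H → H} {lam γ : ℝ} {u u' u'' : ℝ → H}

/-- Energy estimates for `ü + γ u̇ + B u = 0` with `B` cocoercive relative to a zero `z`. -/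
lemma cocoercive_dynamics_estimates (hlam : 0 < lam) (hγ : 0 < γ) (hcond : 1 < lam * γ ^ 2)
    (hu : ∀ t ∈ Ici (0:ℝ), HasDerivWithinAt u (u' t) (Ici 0) t)
    (hu' : ∀ t ∈ Ici (0:ℝ), HasDerivWithinAt u' (u'' t) (Ici 0) t)
    (hu''cont : ContinuousOn u'' (Ici 0))
    (heq : ∀ t ∈ Ici (0:ℝ), u'' t + γ • u' t + B (u t) = 0)
    {z : H} (hB : ∀ x, lam * ‖B x‖ ^ 2 ≤ ⟪B x, x - z⟫) :
    (∃ M, ∀ t ∈ Ici (0:ℝ), ‖u t - z‖ ≤ M) ∧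
    IntegrableOn (fun s => ‖u' s‖ ^ 2) (Ioi 0) ∧
    Tendsto (fun t => ‖u' t‖) atTop (𝓝 0) ∧
    ∃ L, Tendsto (fun t => ‖u t - z‖ ^ 2) atTop (𝓝 L) := by
  set h : ℝ → ℝ := fun t => ‖u t - z‖ ^ 2 / 2 with h_def
  set h' : ℝ → ℝ := fun t => ⟪u t - z, u' t⟫ with h'_def
  have hh : ∀ t ∈ Ici (0:ℝ), HasDerivWithinAt h (h' t) (Ici 0) t := by
    intro t ht
    refine ((((hu t ht).sub_const z).norm_sq).div_const 2).congr_deriv ?_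
    simp only [h'_def]; ring
  have hh' : ∀ t ∈ Ici (0:ℝ),
      HasDerivWithinAt h' (⟪u t - z, u'' t⟫ + ⟪u' t, u' t⟫) (Ici 0) t :=
    fun t ht => ((hu t ht).sub_const z).inner ℝ (hu' t ht)
  have hv : ∀ t ∈ Ici (0:ℝ),
      HasDerivWithinAt (fun t => ‖u' t‖ ^ 2) (2 * ⟪u' t, u'' t⟫) (Ici 0) t :=
    fun t ht => (hu' t ht).norm_sq
  set G : ℝ → ℝ := fun t => h' t + γ * h t + lam * γ * ‖u' t‖ ^ 2 with G_def
  set G' : ℝ → ℝ := fun t => ⟪u t - z, u'' t⟫ + ⟪u' t, u' t⟫ + γ * h' t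
    + lam * γ * (2 * ⟪u' t, u'' t⟫) with G'_def
  have hG : ∀ t ∈ Ici (0:ℝ), HasDerivWithinAt G (G' t) (Ici 0) t :=
    fun t ht => ((hh' t ht).add ((hh t ht).const_mul γ)).add ((hv t ht).const_mul (lam * γ))
  have hG'le : ∀ t ∈ Ici (0:ℝ),
      (lam * γ ^ 2 - 1) * ‖u' t‖ ^ 2 + lam * ‖u'' t‖ ^ 2 ≤ -G' t := by
    intro t ht
    have hBu : B (u t) = -(u'' t + γ • u' t) := eq_neg_of_add_eq_zero_right (heq t ht)
    have h1 := hB (u t)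
    rw [hBu, norm_neg, norm_add_sq_real, inner_neg_left, inner_add_left, norm_smul,
      real_inner_smul_left, real_inner_smul_right, mul_pow, Real.norm_eq_abs, sq_abs,
      real_inner_comm (u t - z) (u'' t), real_inner_comm (u t - z) (u' t),
      real_inner_comm (u' t) (u'' t)] at h1
    simp only [G'_def, h'_def, real_inner_self_eq_norm_sq]
    linarith
  have hc : 0 < lam * γ ^ 2 - 1 := by linarith
  have hG'0 : ∀ t ∈ Ici (0:ℝ), G' t ≤ 0 := by
    intro t ht
    have := hG'le t ht
    have : 0 ≤ (lam * γ ^ 2 - 1) * ‖u' t‖ ^ 2 + lam * ‖u'' t‖ ^ 2 := by positivity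
    linarith
  have hanti : AntitoneOn G (Ici 0) :=
    antitoneOn_of_hasDerivWithinAt_nonpos (convex_Ici 0)
      (fun s hs => (hG s hs).continuousWithinAt)
      (fun s hs => (hG s (interior_subset hs)).mono interior_subset)
      fun s hs => hG'0 s (interior_subset hs)
  have hlg : 0 < lam * γ := by positivity
  obtain ⟨M₀, hM₀⟩ := bddAbove_of_deriv_add_mul_le hγ hh (C := G 0) (by
    intro t ht
    have h1 := hanti self_mem_Ici ht ht
    have h2 : 0 ≤ lam * γ * ‖u' t‖ ^ 2 := by positivity
    simp only [G_def] at h1 ⊢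
    linarith)
  have hM : ∀ t ∈ Ici (0:ℝ), ‖u t - z‖ ≤ √(2 * M₀) := by
    intro t ht
    have := hM₀ t ht
    simp only [h_def] at this
    exact Real.le_sqrt_of_sq_le (by linarith)
  set M := √(2 * M₀)
  have hM0 : 0 ≤ M := Real.sqrt_nonneg _
  have hh'M : ∀ t ∈ Ici (0:ℝ), |h' t| ≤ M * ‖u' t‖ := fun t ht =>
    (abs_real_inner_le_norm _ _).trans (by gcongr; exact hM t ht)
  have hGlow : ∀ t ∈ Ici (0:ℝ), -(M ^ 2 / (4 * (lam * γ))) ≤ G t := by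
    intro t ht
    have h1 := (abs_le.1 (hh'M t ht)).1
    have h2 : 0 ≤ γ * h t := by simp only [h_def]; positivity
    have h3 : 0 ≤ lam * γ * (‖u' t‖ - M / (2 * (lam * γ))) ^ 2 := by positivity
    have h4 : lam * γ * (‖u' t‖ - M / (2 * (lam * γ))) ^ 2
        = lam * γ * ‖u' t‖ ^ 2 - M * ‖u' t‖ + M ^ 2 / (4 * (lam * γ)) := by
      field_simp; ring
    simp only [G_def]
    linarith
  obtain ⟨l, hl⟩ : ∃ l, Tendsto G atTop (𝓝 l) := by
    have hmax : Antitone fun t => G (max t 0) := fun a b hab =>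
      hanti (mem_Ici.2 (le_max_right a 0)) (mem_Ici.2 (le_max_right b 0)) (max_le_max_right 0 hab)
    have hbdd : BddBelow (range fun t => G (max t 0)) := by
      refine ⟨-(M ^ 2 / (4 * (lam * γ))), ?_⟩
      rintro _ ⟨t, rfl⟩
      exact hGlow _ (mem_Ici.2 (le_max_right t 0))
    refine ⟨_, (tendsto_atTop_ciInf hmax hbdd).congr' ?_⟩
    filter_upwards [eventually_ge_atTop 0] with t ht
    rw [max_eq_left ht]
  have hGint : IntegrableOn G' (Ioi 0) :=
    integrableOn_Ioi_deriv_of_nonpos (hG 0 self_mem_Ici).continuousWithinAt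
      (fun t ht => (hG t (Ioi_subset_Ici_self ht)).hasDerivAt (Ici_mem_nhds ht))
      (fun t ht => hG'0 t (Ioi_subset_Ici_self ht)) hl
  have hu'cont : ContinuousOn u' (Ioi 0) := fun t ht =>
    ((hu' t (Ioi_subset_Ici_self ht)).continuousWithinAt).mono Ioi_subset_Ici_self
  have hu''cont' := hu''cont.mono Ioi_subset_Ici_self
  have hint' : IntegrableOn (fun s => ‖u' s‖ ^ 2) (Ioi 0) := by
    refine (hGint.neg.const_mul (lam * γ ^ 2 - 1)⁻¹).mono'
      ((hu'cont.norm.pow 2).aestronglyMeasurable measurableSet_Ioi) ?_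
    filter_upwards [ae_restrict_mem measurableSet_Ioi] with t ht
    have h1 := hG'le t (Ioi_subset_Ici_self ht)
    have h2 : 0 ≤ lam * ‖u'' t‖ ^ 2 := by positivity
    rw [Real.norm_of_nonneg (by positivity), Pi.neg_apply, le_inv_mul_iff₀ hc]
    linarith
  have hint'' : IntegrableOn (fun s => ‖u'' s‖ ^ 2) (Ioi 0) := by
    refine (hGint.neg.const_mul lam⁻¹).mono'
      ((hu''cont'.norm.pow 2).aestronglyMeasurable measurableSet_Ioi) ?_
    filter_upwards [ae_restrict_mem measurableSet_Ioi] with t ht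
    have h1 := hG'le t (Ioi_subset_Ici_self ht)
    have h2 : 0 ≤ (lam * γ ^ 2 - 1) * ‖u' t‖ ^ 2 := by positivity
    rw [Real.norm_of_nonneg (by positivity), Pi.neg_apply, le_inv_mul_iff₀ hlam]
    linarith
  have hint : IntegrableOn (fun s => 2 * ⟪u' s, u'' s⟫) (Ioi 0) := by
    refine (hint'.add hint'').mono'
      ((continuousOn_const.mul (hu'cont.inner hu''cont')).aestronglyMeasurable
        measurableSet_Ioi) ?_
    filter_upwards with t
    have h1 := abs_real_inner_le_norm (u' t) (u'' t)
    rw [Real.norm_eq_abs, abs_mul, abs_two, Pi.add_apply]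
    nlinarith [sq_nonneg (‖u' t‖ - ‖u'' t‖)]
  have hv0 : Tendsto (fun t => ‖u' t‖ ^ 2) atTop (𝓝 0) :=
    tendsto_zero_of_hasDerivAt_of_integrableOn_Ioi
      (fun t ht => (hv t (Ioi_subset_Ici_self ht)).hasDerivAt (Ici_mem_nhds ht)) hint hint'
  have hvel : Tendsto (fun t => ‖u' t‖) atTop (𝓝 0) := by
    simpa using hv0.sqrt
  refine ⟨⟨M, hM⟩, hint', hvel, ?_⟩
  have hh'0 : Tendsto h' atTop (𝓝 0) := by
    refine squeeze_zero_norm' (a := fun t => M * ‖u' t‖) ?_ (by simpa using hvel.const_mul M)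
    filter_upwards [eventually_ge_atTop 0] with t ht using hh'M t ht
  refine ⟨_, (((hl.sub hh'0).sub (hv0.const_mul (lam * γ))).const_mul (2 / γ)).congr fun t => ?_⟩
  simp only [G_def, h_def]
  field_simp
  ring

/-- If the velocity of `ü + γ u̇ + B u = 0` vanishes at infinity and `B` is Lipschitz, then
`B u` vanishes at infinity. -/
lemma tendsto_zero_of_velocity_tendsto_zero (hγ : 0 ≤ γ) {K : ℝ} (hK : 0 ≤ K)
    (hu : ∀ t ∈ Ici (0:ℝ), HasDerivWithinAt u (u' t) (Ici 0) t)
    (hu' : ∀ t ∈ Ici (0:ℝ), HasDerivWithinAt u' (u'' t) (Ici 0) t)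
    (heq : ∀ t ∈ Ici (0:ℝ), u'' t + γ • u' t + B (u t) = 0)
    (hB : ∀ x y, ‖B x - B y‖ ≤ K * ‖x - y‖)
    (hvel : Tendsto (fun t => ‖u' t‖) atTop (𝓝 0)) :
    Tendsto (fun t => B (u t)) atTop (𝓝 0) := by
  have key : ∀ ε > 0, ∀ᶠ t in atTop, ‖B (u t)‖ ≤ ε * (2 + γ + K) := by
    intro ε hε
    obtain ⟨T, hT⟩ := eventually_atTop.1 (hvel.eventually_le_const hε)
    filter_upwards [eventually_ge_atTop (max T 0)] with t ht
    have htT : T ≤ t := (le_max_left _ _).trans ht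
    have ht0 : 0 ≤ t := (le_max_right _ _).trans ht
    have hsub : Icc t (t + 1) ⊆ Ici 0 := fun s hs => ht0.trans hs.1
    have hmem : t ∈ Icc t (t + 1) := ⟨le_rfl, by linarith⟩
    have hmem' : t + 1 ∈ Icc t (t + 1) := ⟨by linarith, le_rfl⟩
    have hdist : ∀ s ∈ Icc t (t + 1), ‖u t - u s‖ ≤ ε := by
      intro s hs
      have h1 := (convex_Icc t (t + 1)).norm_image_sub_le_of_norm_hasDerivWithin_le
        (fun x hx => (hu x (hsub hx)).mono hsub) (fun x hx => hT x (htT.trans hx.1)) hs hmem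
      refine h1.trans ?_
      have : ‖t - s‖ ≤ 1 := by
        rw [Real.norm_eq_abs, abs_le]; constructor <;> linarith [hs.1, hs.2]
      nlinarith
    have h2 := (convex_Icc t (t + 1)).norm_image_sub_le_of_norm_hasDerivWithin_le
      (f := fun s => u' s + s • B (u t)) (f' := fun s => u'' s + (1 : ℝ) • B (u t))
      (C := ε * (γ + K))
      (fun x hx => ((hu' x (hsub hx)).mono hsub).add
        ((hasDerivAt_id x).hasDerivWithinAt.smul_const _))
      (fun x hx => by
        have h3 : u'' x + (1 : ℝ) • B (u t) = -(γ • u' x) + (B (u t) - B (u x)) := by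
          have := heq x (hsub hx)
          rw [one_smul, ← sub_eq_zero, ← this]; abel
        rw [h3]
        refine (norm_add_le _ _).trans ?_
        rw [norm_neg, norm_smul, Real.norm_of_nonneg hγ]
        have h4 := mul_le_mul_of_nonneg_left (hT x (htT.trans hx.1)) hγ
        have h5 := (hB (u t) (u x)).trans (mul_le_mul_of_nonneg_left (hdist x hx) hK)
        linarith) hmem hmem'
    have h6 : B (u t) = (u' (t + 1) + (t + 1) • B (u t) - (u' t + t • B (u t)))
        - u' (t + 1) + u' t := by
      rw [add_smul, one_smul]; abel
    have h7 : ‖t + 1 - t‖ = 1 := by simp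
    rw [h7, mul_one] at h2
    rw [h6]
    refine (norm_add_le _ _).trans ?_
    have h8 := norm_sub_le (u' (t + 1) + (t + 1) • B (u t) - (u' t + t • B (u t))) (u' (t + 1))
    have h9 := hT t htT
    have h10 := hT (t + 1) (by linarith)
    linarith
  rw [NormedAddGroup.tendsto_nhds_zero]
  intro ε hε
  have hpos : 0 < 2 + γ + K := by positivity
  filter_upwards [key (ε / (2 * (2 + γ + K))) (by positivity)] with t ht
  refine ht.trans_lt ?_
  rw [div_mul_eq_mul_div, div_lt_iff₀ (by positivity)]
  nlinarith

end Dynamics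

/-- For a maximal monotone operator `A : H → 2^H` with `A⁻¹(0) ≠ ∅` and
`λγ² > 1`, every trajectory of `ü + γu̇ + A_λ(u) = 0` (with `A_λ` the Yosida approximation,
`A_λ = (1/λ)(I − J_λ)`) converges weakly to a zero of `A`; the velocity is square integrable and
tends to `0` in norm. -/
theorem second_order_yosida_dynamics
    {H : Type*} [NormedAddCommGroup H] [InnerProductSpace ℝ H] [CompleteSpace H]
    (A : H → Set H) (lam γ : ℝ) (hlam : 0 < lam) (hγ : 0 < γ) (hcond : 1 < lam * γ ^ 2)
    (hAmono : ∀ x y xs ys : H, xs ∈ A x → ys ∈ A y → 0 ≤ ⟪xs - ys, x - y⟫)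
    (hAmax : ∀ x xs : H, (∀ y ys : H, ys ∈ A y → 0 ≤ ⟪xs - ys, x - y⟫) → xs ∈ A x)
    (J : H → H) (hJ : ∀ v : H, (1 / lam) • (v - J v) ∈ A (J v))
    (S : Set H) (hS : S = {v : H | 0 ∈ A v}) (hSne : S.Nonempty)
    (u₀ v₀ : H) (u u' u'' : ℝ → H)
    (hu0 : u 0 = u₀) (hv0 : u' 0 = v₀)
    (hu : ∀ t ∈ Ici (0:ℝ), HasDerivWithinAt u (u' t) (Ici 0) t)
    (hu' : ∀ t ∈ Ici (0:ℝ), HasDerivWithinAt u' (u'' t) (Ici 0) t)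
    (hu''cont : ContinuousOn u'' (Ici 0))
    (heq : ∀ t ∈ Ici (0:ℝ), u'' t + γ • u' t + (1 / lam) • (u t - J (u t)) = 0) :
    (∃ uinf ∈ S, ∀ f : H →L[ℝ] ℝ, Tendsto (fun t => f (u t)) atTop (𝓝 (f uinf))) ∧
    IntegrableOn (fun s => ‖u' s‖ ^ 2) (Ici 0) ∧
    Tendsto (fun t => ‖u' t‖) atTop (𝓝 0) := by
  subst hS
  set B : H → H := fun x => (1 / lam) • (x - J x) with B_def
  have hJB : ∀ x, J x = x - lam • B x := fun x => by
    simp only [B_def, smul_smul, mul_one_div_cancel hlam.ne', one_smul, sub_sub_cancel]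
  have hcoco : ∀ x y, lam * ‖B x - B y‖ ^ 2 ≤ ⟪B x - B y, x - y⟫ := by
    intro x y
    have h := hAmono _ _ _ _ (hJ x) (hJ y)
    have h1 : J x - J y = (x - y) - lam • (B x - B y) := by
      rw [hJB x, hJB y, smul_sub]; abel
    change 0 ≤ ⟪B x - B y, J x - J y⟫ at h
    rw [h1, inner_sub_right, real_inner_smul_right, real_inner_self_eq_norm_sq] at h
    linarith
  have hzero : ∀ z, 0 ∈ A z → B z = 0 := by
    intro z hz
    have h := hAmono _ _ _ _ (hJ z) hz
    have h1 : J z - z = -(lam • B z) := by rw [hJB z]; abel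
    change 0 ≤ ⟪B z - 0, J z - z⟫ at h
    rw [h1, sub_zero, inner_neg_right, real_inner_smul_right, real_inner_self_eq_norm_sq] at h
    have h2 : ‖B z‖ ^ 2 ≤ 0 := by nlinarith
    simpa using h2.antisymm (sq_nonneg _)
  have hlip : ∀ x y, ‖B x - B y‖ ≤ (1 / lam) * ‖x - y‖ := by
    intro x y
    have h := (hcoco x y).trans (real_inner_le_norm _ _)
    rw [one_div, le_inv_mul_iff₀ hlam]
    rcases (norm_nonneg (B x - B y)).eq_or_lt with h0 | h0
    · rw [← h0, mul_zero]; positivity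
    · nlinarith
  have hest : ∀ z, 0 ∈ A z → _ := fun z hz =>
    cocoercive_dynamics_estimates hlam hγ hcond hu hu' hu''cont heq (z := z) fun x => by
      simpa [hzero z hz] using hcoco x z
  obtain ⟨z₀, hz₀⟩ := hSne
  obtain ⟨⟨M, hM⟩, hint, hvel, -⟩ := hest z₀ hz₀
  refine ⟨?_, (integrableOn_Ici_iff_integrableOn_Ioi).2 hint, hvel⟩
  have hBu := tendsto_zero_of_velocity_tendsto_zero (B := B) hγ.le (one_div_pos.2 hlam).le
    hu hu' heq hlip hvel
  have hbdd : ∀ᶠ t in atTop, ‖u t‖ ≤ M + ‖z₀‖ := by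
    filter_upwards [eventually_ge_atTop 0] with t ht
    have h1 := hM t ht
    have h2 := norm_sub_norm_le (u t) z₀
    linarith
  obtain ⟨x, hx, hweak⟩ := opial_of_filter (S := {v : H | 0 ∈ A v}) hbdd
    (fun z hz => (hest z hz).2.2.2) (by
      intro U x hU hx
      refine hAmax x 0 fun y ys hys => ?_
      have hBU : Tendsto (fun t => B (u t)) U (𝓝 0) := hBu.mono_left hU
      have hnonneg : ∀ t, 0 ≤ ⟪B (u t) - ys, J (u t) - y⟫ := fun t => hAmono _ _ _ _ (hJ _) hys
      have hbU : ∀ᶠ t in (U : Filter ℝ), ‖u t‖ ≤ M + ‖z₀‖ := hbdd.filter_mono hU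
      have hBuu : Tendsto (fun t => ⟪B (u t), u t⟫) U (𝓝 0) := by
        refine squeeze_zero_norm' (a := fun t => ‖B (u t)‖ * (M + ‖z₀‖)) ?_
          (by simpa using hBU.norm.mul_const (M + ‖z₀‖))
        filter_upwards [hbU] with t ht
        exact (abs_real_inner_le_norm _ _).trans (by gcongr)
      have hlim := (hBuu.sub (hx ys)).sub
        ((hBU.sub_const ys).inner ((hBU.const_smul lam).add_const y))
      have h0 := ge_of_tendsto' hlim (b := 0) fun t => by
        have h := hnonneg t
        have h1 : ⟪B (u t) - ys, J (u t) - y⟫ = ⟪B (u t), u t⟫ - ⟪u t, ys⟫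
            - ⟪B (u t) - ys, lam • B (u t) + y⟫ := by
          rw [hJB (u t), sub_sub, inner_sub_right, inner_sub_left, real_inner_comm (u t) ys]
        rwa [h1] at h
      simp only [smul_zero, zero_add, zero_sub, inner_neg_left] at h0 ⊢
      rw [inner_sub_right, real_inner_comm x ys]
      linarith)
  refine ⟨x, hx, fun f => ?_⟩
  have hf : ∀ w, ⟪w, (InnerProductSpace.toDual ℝ H).symm f⟫ = f w := fun w => by
    rw [real_inner_comm, InnerProductSpace.toDual_symm_apply]
  simpa only [hf] using hweak ((InnerProductSpace.toDual ℝ H).symm f)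
end
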